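/- Let (C,D) be a regular inclusion which has a Cartan envelope, and let (C₁,D₁,α) be a Cartan package for (C,D). Then there exist a Cartan envelope (C₂,D₂,γ) of (C,D) and a surjective *-homomorphism q : C₁ → C₂ such that q ∘ α = γ, q(D₁) = D₂, and ker q ∩ α(C) = (0). (Equivalently, there is a closed two-sided ideal 𝔍 ⊆ C₁ with 𝔍 ∩ α(C) = (0) such that the quotient (C₁/𝔍, D₁/(𝔍 ∩ D₁), q∘α) is a Cartan envelope for (C,D).) -/

import Mathlib

open scoped ComplexOrder
open WeakDual
set_option linter.unusedSectionVars false

namespace RegularInclusion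

variable {A : Type*} [NormedRing A] [StarRing A] [CStarRing A] [CompleteSpace A]
  [NormedAlgebra ℂ A] [StarModule ℂ A]

/-- The set of normalizers of the subalgebra `D` in `A`:
`N(A,D) = {v | v* D v ⊆ D and v D v* ⊆ D}`. -/
def normSet (D : StarSubalgebra ℂ A) : Set A :=
  {v | (∀ d ∈ D, star v * d * v ∈ D) ∧ (∀ d ∈ D, v * d * star v ∈ D)}

lemma normSet.star_mul_self_mem {D : StarSubalgebra ℂ A} {v : A} (hv : v ∈ normSet D) :
    star v * v ∈ D := by simpa using hv.1 1 D.one_mem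

lemma normSet.mul_star_self_mem {D : StarSubalgebra ℂ A} {v : A} (hv : v ∈ normSet D) :
    v * star v ∈ D := by simpa using hv.2 1 D.one_mem

/-- `D` is abelian. -/
def IsAbelian (D : StarSubalgebra ℂ A) : Prop := ∀ x ∈ D, ∀ y ∈ D, x * y = y * x

/-- `(A, D)` is an inclusion: `D` is an abelian closed unital `C*`-subalgebra of `A`. -/
def IsInclusion (D : StarSubalgebra ℂ A) : Prop := IsAbelian D ∧ IsClosed (D : Set A)

/-- `(A, D)` is a regular inclusion: an inclusion for which the closed linear span of the
normalizers is all of `A`. -/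
def IsRegularIncl (D : StarSubalgebra ℂ A) : Prop :=
  IsInclusion D ∧ closure (Submodule.span ℂ (normSet D) : Set A) = Set.univ

/-- `D` is a MASA in `A`: `D` is abelian and contains every element commuting with it. -/
def IsMasa (D : StarSubalgebra ℂ A) : Prop :=
  IsAbelian D ∧ ∀ x : A, (∀ d ∈ D, x * d = d * x) → x ∈ D

/-- The relative commutant `D^c` of `D` in `A`. -/
def relComm (D : StarSubalgebra ℂ A) : StarSubalgebra ℂ A :=
  { Subalgebra.centralizer ℂ (D : Set A) with
    star_mem' := by
      intro x hx d hd
      have h := congrArg star (hx (star d) (star_mem hd))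
      simpa [star_mul] using h.symm }

lemma mem_relComm {D : StarSubalgebra ℂ A} {x : A} :
    x ∈ relComm D ↔ ∀ d ∈ D, d * x = x * d := Iff.rfl

/-- `E : A → A` is a conditional expectation onto `D`. -/
structure IsCondExp [PartialOrder A] [StarOrderedRing A] (D : StarSubalgebra ℂ A)
    (E : A →ₗ[ℂ] A) : Prop where
  mem : ∀ x : A, E x ∈ D
  idOn : ∀ d ∈ D, E d = d
  pos : ∀ x : A, 0 ≤ x → 0 ≤ E x
  bimod : ∀ d ∈ D, ∀ d' ∈ D, ∀ x : A, E (d * x * d') = d * E x * d'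

/-- A linear map is faithful if `E (x* x) = 0` implies `x = 0`. -/
def Faithful (E : A →ₗ[ℂ] A) : Prop := ∀ x : A, E (star x * x) = 0 → x = 0

/-- `(A,D)` is a Cartan inclusion: a regular MASA inclusion admitting a faithful conditional
expectation onto `D`. -/
def IsCartanIncl [PartialOrder A] [StarOrderedRing A] (D : StarSubalgebra ℂ A) : Prop :=
  IsRegularIncl D ∧ IsMasa D ∧ ∃ E : A →ₗ[ℂ] A, IsCondExp D E ∧ Faithful E

/-- The fixed-point set of the partial homeomorphism `β_v` of the character space of `D`:
those characters `σ` with `σ(v*v) > 0` and `σ(v* h v) = σ(h)·σ(v*v)` for all `h ∈ D`. -/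
def fixBeta (D : StarSubalgebra ℂ A) {v : A} (hv : v ∈ normSet D) :
    Set (characterSpace ℂ ↥D) :=
  {σ | 0 < σ (⟨star v * v, normSet.star_mul_self_mem hv⟩ : D) ∧
    ∀ h : D, σ (⟨star v * (h : A) * v, hv.1 (h : A) h.2⟩ : D)
      = σ h * σ (⟨star v * v, normSet.star_mul_self_mem hv⟩ : D)}

/-- A subset `S` of a topological algebra `B` is essential in `B` if the only closed two-sided
ideal of `B` meeting `S` trivially is the zero ideal. -/
def EssentialInSet (B : Type*) [NonUnitalNonAssocRing B] [TopologicalSpace B]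
    (S : Set B) : Prop :=
  ∀ J : TwoSidedIdeal B, IsClosed (J : Set B) → (J : Set B) ∩ S = {0} → J = ⊥

section Two
variable {B : Type*} [NormedRing B] [StarRing B] [CStarRing B] [CompleteSpace B]
  [NormedAlgebra ℂ B] [StarModule ℂ B]

/-- A `*`-homomorphism between inclusions is regular if it maps `D` into `D₁` and
normalizers to normalizers. -/
def IsRegularHom (D : StarSubalgebra ℂ A) (D₁ : StarSubalgebra ℂ B) (α : A →⋆ₐ[ℂ] B) : Prop :=
  (∀ d ∈ D, α d ∈ D₁) ∧ (∀ v ∈ normSet D, α v ∈ normSet D₁)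

/-- `(B, D₁, α)` is a package for the regular inclusion `(A, D)`, witnessed by the faithful
conditional expectation `E₁`: `(B,D₁)` is a regular inclusion, `α` is an injective regular
`*`-homomorphism, `B` is generated as a `C*`-algebra by `α(A) ∪ E₁(α(A))` and `D₁` is
generated by `E₁(α(A))`. -/
def IsPackage [PartialOrder B] [StarOrderedRing B] (D : StarSubalgebra ℂ A)
    (D₁ : StarSubalgebra ℂ B) (α : A →⋆ₐ[ℂ] B) (E₁ : B →ₗ[ℂ] B) : Prop :=
  IsRegularIncl D₁ ∧ Function.Injective α ∧ IsRegularHom D D₁ α ∧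
    IsCondExp D₁ E₁ ∧ Faithful E₁ ∧
    (StarAlgebra.adjoin ℂ (Set.range ⇑α ∪ ⇑E₁ '' Set.range ⇑α)).topologicalClosure = ⊤ ∧
    (StarAlgebra.adjoin ℂ (⇑E₁ '' Set.range ⇑α)).topologicalClosure = D₁

/-- `(D₁, α|_D)` is an essential extension of `D`. -/
def EssentialExtIn (D : StarSubalgebra ℂ A) (D₁ : StarSubalgebra ℂ B) (α : A →⋆ₐ[ℂ] B) : Prop :=
  EssentialInSet ↥D₁ {x : ↥D₁ | ∃ d ∈ D, α d = (x : B)}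

/-- `(B, D₁, α)` is a Cartan envelope of `(A, D)`, witnessed by the faithful conditional
expectation `E₁`: a package for which `(B,D₁)` is moreover a Cartan inclusion (i.e. `D₁` is
a MASA in `B`) and `(D₁, α|_D)` is an essential extension of `D`. -/
def IsCartanEnvelope [PartialOrder B] [StarOrderedRing B] (D : StarSubalgebra ℂ A)
    (D₁ : StarSubalgebra ℂ B) (α : A →⋆ₐ[ℂ] B) (E₁ : B →ₗ[ℂ] B) : Prop :=
  IsPackage D D₁ α E₁ ∧ IsMasa D₁ ∧ EssentialExtIn D D₁ α

end Two

/-- The set of normalizers of `Dα` relative to the subalgebra `Cα`. -/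
def normSetRel (Cα Dα : StarSubalgebra ℂ A) : Set A :=
  {v | v ∈ Cα ∧ (∀ d ∈ Dα, star v * d * v ∈ Dα) ∧ (∀ d ∈ Dα, v * d * star v ∈ Dα)}

/-- `φ` is an eigenfunctional for `(A,D)` with range character `r` and source character `s`. -/
def IsEigen (D : StarSubalgebra ℂ A) (φ : A →L[ℂ] ℂ) (r s : ↥D →ₐ[ℂ] ℂ) : Prop :=
  φ ≠ 0 ∧ ∀ (d₁ d₂ : D) (x : A), φ ((d₁ : A) * x * (d₂ : A)) = r d₁ * φ x * s d₂

/-- `f` is a state on `A`. -/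
def IsState (f : A →ₗ[ℂ] ℂ) : Prop := f 1 = 1 ∧ ∀ x : A, 0 ≤ f (star x * x)

/-- `f ∈ Mod(A,D)`: a state whose restriction to `D` is multiplicative (hence a character). -/
def InMod (D : StarSubalgebra ℂ A) (f : A →ₗ[ℂ] ℂ) : Prop :=
  IsState f ∧ ∀ d₁ d₂ : D, f ((d₁ : A) * (d₂ : A)) = f (d₁ : A) * f (d₂ : A)

/-- `f` is a compatible state: a state with `|f(v)|² ∈ {0, f(v*v)}` for every normalizer `v`. -/
def IsCompatState (D : StarSubalgebra ℂ A) (f : A →ₗ[ℂ] ℂ) : Prop :=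
  IsState f ∧ ∀ v ∈ normSet D, f v = 0 ∨ (Complex.normSq (f v) : ℂ) = f (star v * v)

/-- `φ` is a compatible eigenfunctional: `|φ(v)|² ∈ {0, s(φ)(v*v)}` for every normalizer `v`. -/
def IsCompatEigen (D : StarSubalgebra ℂ A) (φ : A →L[ℂ] ℂ) (r s : ↥D →ₐ[ℂ] ℂ) : Prop :=
  IsEigen D φ r s ∧ ∀ v, ∀ hv : v ∈ normSet D,
    φ v = 0 ∨ (Complex.normSq (φ v) : ℂ)
      = s (⟨star v * v, normSet.star_mul_self_mem hv⟩ : D)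

/-- The eigenfunctional `[v,f] : x ↦ f(v* x) / f(v* v)^{1/2}`. -/
noncomputable def evf (f : A →ₗ[ℂ] ℂ) (v : A) (x : A) : ℂ :=
  f (star v * x) / (Real.sqrt (f (star v * v)).re : ℂ)

/-- A bundled unital `C*`-algebra (with its canonical partial order). -/
structure CSA where
  carrier : Type
  [nr : NormedRing carrier]
  [sr : StarRing carrier]
  [cs : CStarRing carrier]
  [cp : CompleteSpace carrier]
  [na : NormedAlgebra ℂ carrier]
  [sm : StarModule ℂ carrier]
  [po : PartialOrder carrier]
  [sor : StarOrderedRing carrier]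

attribute [instance] CSA.nr CSA.sr CSA.cs CSA.cp CSA.na CSA.sm CSA.po CSA.sor

end RegularInclusion

namespace RegularInclusion

variable {A : Type*} [NormedRing A] [StarRing A] [CStarRing A] [CompleteSpace A]
  [NormedAlgebra ℂ A] [StarModule ℂ A]

variable {B : Type*} [NormedRing B] [StarRing B] [CStarRing B] [CompleteSpace B]
  [NormedAlgebra ℂ B] [StarModule ℂ B] [PartialOrder B] [StarOrderedRing B]

section CondExp

variable {D : StarSubalgebra ℂ B} {E : B →ₗ[ℂ] B}

lemma IsCondExp.exists_bound (hE : IsCondExp D E) : ∃ C : ℝ, 0 ≤ C ∧ ∀ x, ‖E x‖ ≤ C * ‖x‖ := by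
  let _ : CStarAlgebra B := {}
  obtain ⟨C, hC⟩ := (PositiveLinearMap.mk₀ E hE.pos).exists_norm_apply_le
  exact ⟨C, C.2, hC⟩

lemma IsCondExp.continuous (hE : IsCondExp D E) : Continuous E := by
  obtain ⟨C, -, hC⟩ := hE.exists_bound
  exact AddMonoidHomClass.continuous_of_bound E C hC

lemma IsCondExp.map_star (hE : IsCondExp D E) (x : B) : E (star x) = star (E x) := by
  let _ : CStarAlgebra B := {}
  exact StarHomClass.map_star (PositiveLinearMap.mk₀ E hE.pos) x

lemma IsCondExp.left (hE : IsCondExp D E) {d : B} (hd : d ∈ D) (x : B) :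
    E (d * x) = d * E x := by
  simpa using hE.bimod d hd 1 D.one_mem x

lemma IsCondExp.right (hE : IsCondExp D E) {d : B} (hd : d ∈ D) (x : B) :
    E (x * d) = E x * d := by
  simpa using hE.bimod 1 D.one_mem d hd x

lemma normSet.star_mem {D : StarSubalgebra ℂ A} {v : A} (hv : v ∈ normSet D) :
    star v ∈ normSet D := by
  refine ⟨fun d hd => ?_, fun d hd => ?_⟩
  · simpa using hv.2 d hd
  · simpa using hv.1 d hd

lemma normSet.mul_mem {D : StarSubalgebra ℂ A} {v w : A} (hv : v ∈ normSet D)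
    (hw : w ∈ normSet D) : v * w ∈ normSet D := by
  refine ⟨fun d hd => ?_, fun d hd => ?_⟩
  · simpa [mul_assoc] using hw.1 _ (hv.1 d hd)
  · simpa [mul_assoc] using hv.2 _ (hw.2 d hd)

lemma mem_normSet_of_mem {D : StarSubalgebra ℂ A} {d : A} (hd : d ∈ D) : d ∈ normSet D :=
  ⟨fun _ h => mul_mem (mul_mem (star_mem hd) h) hd, fun _ h => mul_mem (mul_mem hd h) (star_mem hd)⟩

lemma IsCondExp.mul_conj (hE : IsCondExp D E) (hab : IsAbelian D) {w : B} (hw : w ∈ normSet D)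
    {d : B} (hd : d ∈ D) : E w * (star w * d * w) = d * E w * (star w * w) := by
  have h : w * (star w * d * w) = d * w * (star w * w) := by
    have := hab _ (normSet.mul_star_self_mem hw) d hd
    linear_combination (norm := noncomm_ring) this * w
  have := congrArg E h
  rwa [hE.right (hw.1 d hd), hE.right (normSet.star_mul_self_mem hw), hE.left hd] at this

lemma IsCondExp.star_mul_mem (hE : IsCondExp D E) (hm : IsMasa D) {w : B}
    (hw : w ∈ normSet D) : star w * E w ∈ D := by
  have hab := hm.1
  have hEw := hE.mem w
  have ha := (normSet.mul_star_self_mem hw)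
  have key : ∀ d ∈ D, (w * d * star w) * E w = d * (w * star w) * E w := by
    intro d hd
    have h : (w * d * star w) * w = (w * star w) * w * d := by
      have := hab _ (normSet.star_mul_self_mem hw) d hd
      linear_combination (norm := noncomm_ring) -w * this
    have := congrArg E h
    rw [hE.left (hw.2 d hd), hE.right hd, hE.left ha] at this
    have c1 := hab d hd _ hEw
    have c2 := hab d hd _ ha
    linear_combination (norm := noncomm_ring) this - w * star w * c1 - c2 * E w
  refine hm.2 _ fun d hd => ?_
  have hy : star ((star w * d - d * star w) * E w) * ((star w * d - d * star w) * E w) = 0 := by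
    have k1 := key d hd
    have k2 := key (star d) (star_mem hd)
    have k3 := key (star d * d) (mul_mem (star_mem hd) hd)
    have c1 := hab d hd _ hEw
    simp only [star_mul, star_sub, star_star]
    have c4 := congrArg (star d * · ) k1
    linear_combination (norm := noncomm_ring) star (E w) * (k3 - c4 - k2 * d -
      w * star d * star w * c1 + star d * w * star w * c1)
  have := CStarRing.star_mul_self_eq_zero_iff _ |>.1 hy
  have c1 := hab d hd _ hEw
  linear_combination (norm := noncomm_ring) this - star w * c1

lemma IsCondExp.star_mul_eq (hE : IsCondExp D E) (hm : IsMasa D) {w : B}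
    (hw : w ∈ normSet D) : star w * E w = star (E w) * E w := by
  rw [← hE.idOn _ (hE.star_mul_mem hm hw), hE.right (hE.mem w), hE.map_star]

lemma IsCondExp.star_conj_mul (hE : IsCondExp D E) (hm : IsMasa D) {v w : B}
    (hv : v ∈ normSet D) (hw : w ∈ normSet D) :
    star (E (star v * w * v)) * (star v * E w * v) =
      star (star v * E w * v) * (star v * E w * v) := by
  have hab := hm.1
  have hEw := hE.mem w
  have he := hv.1 _ hEw
  have h1 := hE.star_mul_eq hm hw
  have c1 := hab _ hEw _ (normSet.mul_star_self_mem hv)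
  have h2 : star (star v * w * v) * (star v * E w * v) =
      star (star v * E w * v) * (star v * E w * v) := by
    simp only [star_mul, star_star]
    linear_combination (norm := noncomm_ring)
      star v * (h1 * (v * star v) - star w * c1 + star (E w) * c1) * v
  rw [← hE.idOn _ (mul_mem (star_mem he) he), ← h2, hE.right he, hE.map_star]

lemma eq_zero_of_mul_sq {x b : A} (hb : star b = b) (h : x * b * b = 0) : x * b = 0 := by
  rw [← CStarRing.mul_star_self_eq_zero_iff, star_mul, hb]
  linear_combination (norm := noncomm_ring) h * star x

lemma IsCondExp.map_conj_normSet (hE : IsCondExp D E) (hm : IsMasa D) {v w : B}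
    (hv : v ∈ normSet D) (hw : w ∈ normSet D) :
    E (star v * w * v) = star v * E w * v := by
  have hab := hm.1
  have hEw := hE.mem w
  set m := E (star v * w * v) with hmdef
  have hmD : m ∈ D := hE.mem _
  set e := star v * E w * v with he
  have heD : e ∈ D := hv.1 _ hEw
  have h1 : star m * e = star e * e := hE.star_conj_mul hm hv hw
  have haD := (normSet.mul_star_self_mem hv)
  have hbD := (normSet.star_mul_self_mem hv)
  have hn := normSet.mul_mem (normSet.mul_mem (normSet.star_mem hv) hw) hv
  have h2 := hE.star_conj_mul hm (normSet.star_mem hv) hn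
  have h3 : E (star (star v) * (star v * w * v) * star v) = (v * star v) * E w * (v * star v) := by
    rw [← hE.left haD, ← hE.right haD]; congr 1; simp only [star_star]; noncomm_ring
  rw [h3, ← hmdef] at h2
  set b := star v * v with hb
  have hbs : star b = b := by simp [hb]
  set x := (star e - star m) * m with hx
  have hxD : x ∈ D := mul_mem (sub_mem (star_mem heD) (star_mem hmD)) hmD
  have cbm := hab b hbD m hmD
  have cbm' := hab b hbD _ (star_mem hmD)
  have cbe' := hab b hbD _ (star_mem heD)
  have h4 : x * b * b * b = 0 := by
    have := congrArg (fun y => star v * y * v) h2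
    simp only [star_mul, star_star] at this
    have e' : star e = star v * star (E w) * v := by simp [he, mul_assoc]
    have l : star v * (v * star v * (star (E w) * (v * star v)) * (v * m * star v)) * v =
        b * star e * b * m * b := by
      rw [e', hb]; noncomm_ring
    have r : star v * (v * (star m * star v) * (v * m * star v)) * v = b * star m * b * m * b := by
      rw [hb]; noncomm_ring
    rw [l, r] at this
    have s1 : ∀ z ∈ D, b * z * b * m * b = z * m * b * b * b := fun z hz => by
      have cz := hab b hbD z hz
      linear_combination (norm := noncomm_ring)
        cz * b * m * b + z * b * cbm * b + z * cbm * b * b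
    rw [s1 _ (star_mem heD), s1 _ (star_mem hmD)] at this
    rw [hx]
    linear_combination (norm := noncomm_ring) this
  have h5 : x * b = 0 := eq_zero_of_mul_sq hbs (eq_zero_of_mul_sq hbs h4)
  have h6 : x * star v = 0 := by
    rw [← CStarRing.mul_star_self_eq_zero_iff, star_mul, star_star]
    linear_combination (norm := skip) h5 * star x
    rw [hb]; noncomm_ring
  have h7 : x * m = 0 := by
    rw [hmdef, ← hE.left hxD, ← mul_assoc, ← mul_assoc, h6]; simp
  have h8 : x * star m = 0 := by
    rw [← CStarRing.mul_star_self_eq_zero_iff, star_mul, star_star]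
    have := hab _ (star_mem hmD) _ hmD
    linear_combination (norm := noncomm_ring) h7 * star m * star x + x * this * star x
  have h9 : x = 0 := by
    rw [← CStarRing.mul_star_self_eq_zero_iff]
    have : star x = star m * (e - m) := by simp [hx]
    rw [this, ← mul_assoc, h8, zero_mul]
  have h10 : star (m - e) * (m - e) = 0 := by
    rw [hx] at h9
    rw [star_sub]
    linear_combination (norm := noncomm_ring) -h9 - h1
  exact sub_eq_zero.1 ((CStarRing.star_mul_self_eq_zero_iff _).1 h10)

lemma eq_of_regular {F : Type*} [NormedAddCommGroup F] [NormedSpace ℂ F]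
    {D : StarSubalgebra ℂ A} (hreg : IsRegularIncl D) {f g : A →ₗ[ℂ] F}
    (hf : Continuous f) (hg : Continuous g) (h : ∀ v ∈ normSet D, f v = g v) (x : A) :
    f x = g x := by
  have hx : x ∈ closure (Submodule.span ℂ (normSet D) : Set A) := hreg.2 ▸ Set.mem_univ x
  refine (Set.EqOn.closure (s := (Submodule.span ℂ (normSet D) : Set A)) ?_ hf hg) hx
  exact LinearMap.eqOn_span h

/-- The conditional expectation of a Cartan inclusion is covariant for normalizers. -/
lemma IsCondExp.map_conj (hE : IsCondExp D E) (hreg : IsRegularIncl D) (hm : IsMasa D) {v : B}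
    (hv : v ∈ normSet D) (x : B) : E (star v * x * v) = star v * E x * v := by
  have hc := hE.continuous
  refine eq_of_regular hreg (f := E ∘ₗ LinearMap.mulRight ℂ v ∘ₗ LinearMap.mulLeft ℂ (star v))
    (g := (LinearMap.mulRight ℂ v ∘ₗ LinearMap.mulLeft ℂ (star v)) ∘ₗ E) ?_ ?_ ?_ x
  · exact hc.comp ((continuous_const.mul continuous_id).mul continuous_const)
  · exact (continuous_const.mul hc).mul continuous_const
  · exact fun w hw => hE.map_conj_normSet hm hv hw

end CondExp

section Range

lemma exists_preimage_norm_le_of_isSelfAdjoint {P Q : Type*} [CStarAlgebra P] [CStarAlgebra Q]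
    (f : P →⋆ₐ[ℂ] Q) {b : P} (hb : IsSelfAdjoint b) : ∃ a : P, f a = f b ∧ ‖a‖ ≤ ‖f b‖ := by
  set r := ‖f b‖ with hr
  have hfb : IsSelfAdjoint (f b) := hb.map f
  let g : ℝ → ℝ := fun t => max (-r) (min t r)
  have hg : Continuous g := by fun_prop
  have hr0 : 0 ≤ r := norm_nonneg _
  refine ⟨cfc g b, ?_, ?_⟩
  · have hf : Continuous f := AddMonoidHomClass.continuous_of_bound f 1 fun x => by
      simpa using NonUnitalStarAlgHom.norm_apply_le f x
    have := StarAlgHomClass.map_cfc (S := ℂ) f g b (hg.continuousOn) hf hb hfb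
    rw [this]
    conv_rhs => rw [← cfc_id ℝ (f b)]
    rcases subsingleton_or_nontrivial Q with hQ | hQ
    · exact Subsingleton.elim _ _
    refine cfc_congr fun t ht => ?_
    have h1 : |t| ≤ r := by simpa using spectrum.norm_le_norm_of_mem ht
    have := abs_le.1 h1
    simp only [g, id]
    rw [min_eq_left this.2, max_eq_right this.1]
  · refine norm_cfc_le hr0 fun t _ => ?_
    rw [Real.norm_eq_abs, abs_le]
    exact ⟨le_max_left _ _, max_le (by linarith) (min_le_right _ _)⟩

/-- The range of a `*`-homomorphism between `C*`-algebras is closed. -/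
lemma isClosed_range_starAlgHom {P Q : Type*} [CStarAlgebra P] [CStarAlgebra Q]
    (f : P →⋆ₐ[ℂ] Q) : IsClosed (Set.range f) := by
  have hf : ∀ x, ‖f x‖ ≤ 1 * ‖x‖ := fun x => by
    simpa using NonUnitalStarAlgHom.norm_apply_le f x
  let F : NormedAddGroupHom P Q := AddMonoidHom.mkNormedAddGroupHom (f : P →+ Q) 1 hf
  have hF : ∀ x, F x = f x := fun _ => rfl
  have key : F.SurjectiveOnWith F.range 2 := by
    rintro y ⟨b, rfl⟩
    have hn : ∀ z : Q, ‖(realPart z : Q)‖ ≤ ‖z‖ ∧ ‖(imaginaryPart z : Q)‖ ≤ ‖z‖ := fun z =>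
      ⟨realPart.norm_le z, imaginaryPart.norm_le z⟩
    obtain ⟨a₁, h₁, h₁'⟩ := exists_preimage_norm_le_of_isSelfAdjoint f (realPart b).2
    obtain ⟨a₂, h₂, h₂'⟩ := exists_preimage_norm_le_of_isSelfAdjoint f (imaginaryPart b).2
    have hs : ∀ (r : ℝ) (x : P), f (r • x) = r • f x := fun r x => by
      rw [← Complex.coe_smul, map_smul, Complex.coe_smul]
    have e₁ : f (realPart b : P) = realPart (f b) := by
      rw [realPart_apply_coe, realPart_apply_coe, hs, map_add, StarHomClass.map_star]
    have e₂ : f (imaginaryPart b : P) = imaginaryPart (f b) := by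
      rw [imaginaryPart_apply_coe, imaginaryPart_apply_coe, map_smul, hs, map_sub,
        StarHomClass.map_star]
    refine ⟨a₁ + Complex.I • a₂, ?_, ?_⟩
    · change f _ = f b
      rw [map_add, map_smul, h₁, h₂, ← map_smul, ← map_add, realPart_add_I_smul_imaginaryPart]
    · rw [e₁] at h₁'
      rw [e₂] at h₂'
      have := hn (f b)
      have h3 := norm_add_le a₁ (Complex.I • a₂)
      rw [norm_smul, Complex.norm_I, one_mul] at h3
      change _ ≤ 2 * ‖f b‖
      linarith
  have := controlled_closure_of_complete (f := F) two_pos one_pos key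
  refine isClosed_of_closure_subset fun y hy => ?_
  obtain ⟨g, hg, -⟩ := this y hy
  exact ⟨g, hg⟩

lemma isClosed_image_starSubalgebra {P Q : Type*}
    [NormedRing P] [StarRing P] [CStarRing P] [CompleteSpace P] [NormedAlgebra ℂ P] [StarModule ℂ P]
    [NormedRing Q] [StarRing Q] [CStarRing Q] [CompleteSpace Q] [NormedAlgebra ℂ Q] [StarModule ℂ Q]
    {S : StarSubalgebra ℂ P} (hS : IsClosed (S : Set P)) (f : P →⋆ₐ[ℂ] Q) :
    IsClosed (f '' S) := by
  let _ : CStarAlgebra P := {}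
  let _ : CStarAlgebra Q := {}
  have := hS
  have h := isClosed_range_starAlgHom (f.comp S.subtype)
  convert h
  ext y
  simp

end Range

section Approx

/-- For a self-adjoint element `h`, `h (1 - h e)²` can be made small. -/
lemma exists_approx_selfAdjoint {P : Type*} [CStarAlgebra P] {h : P} (hh : IsSelfAdjoint h)
    {ε : ℝ} (hε : 0 < ε) :
    ∃ e : P, IsSelfAdjoint e ∧ Commute h e ∧ ‖(1 - h * e) * h * (1 - h * e)‖ ≤ ε := by
  let g : ℝ → ℝ := fun t => t / (t ^ 2 + ε ^ 2)
  have hpos : ∀ t : ℝ, 0 < t ^ 2 + ε ^ 2 := fun t => by positivity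
  have hg : Continuous g := Continuous.div (by fun_prop) (by fun_prop) fun t => (hpos t).ne'
  refine ⟨cfc g h, cfc_predicate g h, ?_, ?_⟩
  · simpa only [cfc_id ℝ h] using cfc_commute_cfc (id : ℝ → ℝ) g h
  · have e1 : (1 - h * cfc g h) = cfc (fun t : ℝ => 1 - t * g t) h := by
      rw [cfc_sub (fun _ => 1) (fun t => t * g t) h, cfc_mul (fun t => t) g h, cfc_const_one ℝ h,
        cfc_id' ℝ h]
    have e2 : (1 - h * cfc g h) * h * (1 - h * cfc g h) =
        cfc (fun t : ℝ => (1 - t * g t) * t * (1 - t * g t)) h := by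
      rw [cfc_mul (fun t : ℝ => (1 - t * g t) * t) (fun t => 1 - t * g t) h,
        cfc_mul (fun t : ℝ => (1 - t * g t)) (fun t => t) h, cfc_id' ℝ h, e1]
    rw [e2]
    refine norm_cfc_le hε.le fun t _ => ?_
    have e3 : 1 - t * g t = ε ^ 2 / (t ^ 2 + ε ^ 2) := by
      have := (hpos t).ne'
      simp only [g]; field_simp; ring
    rw [e3, Real.norm_eq_abs, abs_mul, abs_mul, abs_of_pos (div_pos (by positivity) (hpos t))]
    have h1 : ε ^ 2 / (t ^ 2 + ε ^ 2) * |t| ≤ ε := by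
      rw [div_mul_eq_mul_div, div_le_iff₀ (hpos t)]
      rw [← sq_abs t]
      nlinarith [sq_nonneg (|t| - ε), abs_nonneg t, mul_nonneg hε.le (sq_nonneg (|t| - ε))]
    have h2 : ε ^ 2 / (t ^ 2 + ε ^ 2) ≤ 1 := by
      rw [div_le_one (hpos t)]; nlinarith [sq_nonneg t]
    have h3 : 0 ≤ ε ^ 2 / (t ^ 2 + ε ^ 2) := (div_pos (by positivity) (hpos t)).le
    calc _ ≤ ε * 1 := mul_le_mul h1 h2 h3 hε.le
      _ = ε := mul_one _

variable {D : StarSubalgebra ℂ A}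

/-- `w` is a limit of elements `w (w* w) e` with `e ∈ D`. -/
lemma exists_mul_approx (hD : IsClosed (D : Set A)) {w : A} (hw : star w * w ∈ D)
    {ε : ℝ} (hε : 0 < ε) : ∃ e ∈ D, star e = e ∧ ‖w - w * (star w * w) * e‖ ≤ ε := by
  let _ : CStarAlgebra A := {}
  have := hD
  obtain ⟨e, he, hc, hn⟩ := exists_approx_selfAdjoint (P := D) (h := ⟨star w * w, hw⟩)
    (Subtype.ext (by simp)) (sq_pos_of_pos hε)
  have he' : star (e : A) = e := congrArg Subtype.val he
  have hc' : (star w * w) * (e : A) = e * (star w * w) := congrArg Subtype.val hc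
  refine ⟨e, e.2, he', ?_⟩
  have h1 : ‖(1 - (star w * w) * (e : A)) * (star w * w) * (1 - (star w * w) * (e : A))‖
      ≤ ε ^ 2 := hn
  have h2 : star (w - w * (star w * w) * e) * (w - w * (star w * w) * e) =
      (1 - (star w * w) * (e : A)) * (star w * w) * (1 - (star w * w) * (e : A)) := by
    simp only [star_sub, star_mul, star_star, he']
    linear_combination (norm := noncomm_ring)
      hc' * (star w * w - (star w * w) * (star w * w) * e)
  rw [← h2, CStarRing.norm_star_mul_self] at h1
  nlinarith [norm_nonneg (w - w * (star w * w) * e)]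

end Approx

section CharExt

variable {D : StarSubalgebra ℂ B} {E : B →ₗ[ℂ] B}

lemma characterSpace_norm_le {D : StarSubalgebra ℂ A} (hD : IsClosed (D : Set A))
    (σ : characterSpace ℂ D) (d : D) : ‖σ d‖ ≤ ‖d‖ := by
  let _ : CStarAlgebra A := {}
  have := hD
  exact NonUnitalStarAlgHom.norm_apply_le σ d

lemma characterSpace_map_star {D : StarSubalgebra ℂ A} (hD : IsClosed (D : Set A))
    (σ : characterSpace ℂ D) (d : D) : σ (star d) = star (σ d) := by
  let _ : CStarAlgebra A := {}
  have := hD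
  exact StarHomClass.map_star σ d

/-- The functional `σ ∘ E` on `B` attached to a character `σ` of `D`. -/
noncomputable def charExt (hE : IsCondExp D E) (σ : characterSpace ℂ D) : B →L[ℂ] ℂ :=
  { toFun := fun x => σ ⟨E x, hE.mem x⟩
    map_add' := fun x y => by
      rw [← map_add]; congr 1; exact Subtype.ext (map_add E x y)
    map_smul' := fun c x => by
      rw [RingHom.id_apply, ← map_smul]; congr 1; exact Subtype.ext (map_smul E c x)
    cont := (map_continuous σ).comp (hE.continuous.subtype_mk _) }

variable {hE : IsCondExp D E} {σ : characterSpace ℂ D}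

lemma charExt_apply (x : B) : charExt hE σ x = σ ⟨E x, hE.mem x⟩ := rfl

lemma charExt_coe (d : D) : charExt hE σ (d : B) = σ d := by
  rw [charExt_apply]; congr 1; exact Subtype.ext (hE.idOn _ d.2)

lemma charExt_map (x : B) : charExt hE σ (E x) = charExt hE σ x :=
  charExt_coe ⟨E x, hE.mem x⟩

lemma charExt_left {d : B} (hd : d ∈ D) (x : B) :
    charExt hE σ (d * x) = charExt hE σ d * charExt hE σ x := by
  simp only [charExt_apply]
  rw [← map_mul]; congr 1; refine Subtype.ext ?_
  simp [hE.left hd, hE.idOn d hd]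

lemma charExt_right {d : B} (hd : d ∈ D) (x : B) :
    charExt hE σ (x * d) = charExt hE σ x * charExt hE σ d := by
  simp only [charExt_apply]
  rw [← map_mul]; congr 1; refine Subtype.ext ?_
  simp [hE.right hd, hE.idOn d hd]

lemma charExt_one : charExt hE σ 1 = 1 := by
  have := charExt_coe (hE := hE) (σ := σ) 1
  simpa using this

lemma charExt_star (hD : IsClosed (D : Set B)) (x : B) :
    charExt hE σ (star x) = star (charExt hE σ x) := by
  simp only [charExt_apply]
  rw [← characterSpace_map_star hD]; congr 1
  exact Subtype.ext (hE.map_star x)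

end CharExt

section Generate

lemma mem_of_forall_norm_sub_le {S : Set A} (hS : IsClosed S) {x : A}
    (h : ∀ ε > 0, ∃ y ∈ S, ‖x - y‖ ≤ ε) : x ∈ S := by
  rw [← hS.closure_eq, Metric.mem_closure_iff]
  intro ε hε
  obtain ⟨y, hy, hxy⟩ := h (ε / 2) (half_pos hε)
  exact ⟨y, hy, by rw [dist_eq_norm]; linarith⟩

variable {D : StarSubalgebra ℂ A}

/-- The closed span of `N D`, for a `*`-monoid `N` of normalizers of `D`, is a `C*`-algebra. -/
lemma exists_starSubalgebra_eq_closure_span (hD : IsClosed (D : Set A)) (hab : IsAbelian D)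
    {N : Set A} (hN : N ⊆ normSet D) (hone : (1 : A) ∈ N) (hstar : ∀ w ∈ N, star w ∈ N)
    (hmul : ∀ v ∈ N, ∀ w ∈ N, v * w ∈ N) :
    ∃ T : StarSubalgebra ℂ A, (T : Set A) =
      closure (Submodule.span ℂ {x | ∃ w ∈ N, ∃ d ∈ D, x = w * d} : Set A) := by
  set G : Set A := {x | ∃ w ∈ N, ∃ d ∈ D, x = w * d} with hG
  set S := (Submodule.span ℂ G).topologicalClosure with hS
  have hSc : IsClosed (S : Set A) := Submodule.isClosed_topologicalClosure _
  have hSG : ∀ x ∈ G, x ∈ S := fun x hx =>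
    Submodule.le_topologicalClosure _ (Submodule.subset_span hx)
  have hdw : ∀ d ∈ D, ∀ w ∈ N, d * w ∈ S := by
    intro d hd w hw
    refine mem_of_forall_norm_sub_le hSc fun ε hε => ?_
    have hwn := hN hw
    obtain ⟨e, heD, -, hn⟩ := exists_mul_approx hD (normSet.star_mul_self_mem hwn)
      (div_pos hε (by positivity : 0 < ‖d‖ + 1))
    refine ⟨w * ((star w * d * w) * e), hSG _ ⟨w, hw, _, mul_mem (hwn.1 d hd) heD, rfl⟩, ?_⟩
    have h1 : d * w - w * ((star w * d * w) * e) = d * (w - w * (star w * w) * e) := by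
      have := hab _ hd _ (normSet.mul_star_self_mem hwn)
      linear_combination (norm := noncomm_ring) this * w * e
    rw [h1]
    calc _ ≤ ‖d‖ * (ε / (‖d‖ + 1)) := (norm_mul_le _ _).trans (by gcongr)
      _ ≤ (‖d‖ + 1) * (ε / (‖d‖ + 1)) := by gcongr; linarith
      _ = ε := by field_simp
  have hleft : ∀ w ∈ N, ∀ x ∈ S, w * x ∈ S := by
    intro w hw x hx
    refine hSc.closure_subset (map_mem_closure (t := (S : Set A)) (continuous_const_mul w) hx ?_)
    intro y hy
    induction hy using Submodule.span_induction with
    | mem y hy =>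
      obtain ⟨v, hv, d, hd, rfl⟩ := hy
      exact hSG _ ⟨w * v, hmul w hw v hv, d, hd, by rw [mul_assoc]⟩
    | zero => simp
    | add y z _ _ h1 h2 => simpa [mul_add] using add_mem h1 h2
    | smul c y _ h1 => simpa using S.smul_mem c h1
  have hright : ∀ d ∈ D, ∀ x ∈ S, x * d ∈ S := by
    intro d hd x hx
    refine hSc.closure_subset (map_mem_closure (t := (S : Set A)) (f := fun x => x * d)
      (continuous_mul_const d) hx ?_)
    intro y hy
    change y * d ∈ S
    induction hy using Submodule.span_induction with
    | mem y hy =>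
      obtain ⟨v, hv, d', hd', rfl⟩ := hy
      exact hSG _ ⟨v, hv, d' * d, mul_mem hd' hd, by simp only [mul_assoc]⟩
    | zero => simp
    | add y z _ _ h1 h2 => simpa [add_mul] using add_mem h1 h2
    | smul c y _ h1 => simpa using S.smul_mem c h1
  have hmulS : ∀ x ∈ S, ∀ y ∈ S, x * y ∈ S := by
    intro x hx y hy
    refine hSc.closure_subset (map_mem_closure₂ (u := (S : Set A)) continuous_mul hx hy ?_)
    intro a ha b hb
    induction ha using Submodule.span_induction with
    | mem a ha =>
      obtain ⟨v, hv, d, hd, rfl⟩ := ha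
      induction hb using Submodule.span_induction with
      | mem b hb =>
        obtain ⟨w, hw, d', hd', rfl⟩ := hb
        have := hleft v hv _ (hright d' hd' _ (hdw d hd w hw))
        show _ ∈ S
        simpa only [mul_assoc] using this
      | zero => simp
      | add y z _ _ h1 h2 => simpa [mul_add] using add_mem h1 h2
      | smul c y _ h1 => simpa using S.smul_mem c h1
    | zero => simp
    | add y z _ _ h1 h2 => simpa [add_mul] using add_mem h1 h2
    | smul c y _ h1 => simpa using S.smul_mem c h1
  have hstarS : ∀ x ∈ S, star x ∈ S := by
    intro x hx
    refine hSc.closure_subset (map_mem_closure (t := (S : Set A)) continuous_star hx ?_)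
    intro y hy
    induction hy using Submodule.span_induction with
    | mem y hy =>
      obtain ⟨v, hv, d, hd, rfl⟩ := hy
      simpa using hdw _ (star_mem hd) _ (hstar v hv)
    | zero => simp
    | add y z _ _ h1 h2 => simpa using add_mem h1 h2
    | smul c y _ h1 => simpa using S.smul_mem (star c) h1
  have h1S : (1 : A) ∈ S := hSG _ ⟨1, hone, 1, D.one_mem, by simp⟩
  exact ⟨{ carrier := S
           mul_mem' := fun {a b} ha hb => hmulS a ha b hb
           add_mem' := fun ha hb => S.add_mem ha hb
           algebraMap_mem' := fun c => by
            rw [Algebra.algebraMap_eq_smul_one]; exact S.smul_mem c h1S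
           star_mem' := fun {a} ha => hstarS a ha }, rfl⟩

/-- Conjugation by `w` preserves a `C*`-algebra if it maps generators into it. -/
lemma conj_mem_topologicalClosure_adjoin {G : Set A}
    (hab : IsAbelian (StarAlgebra.adjoin ℂ G).topologicalClosure) {w : A}
    (h1 : star w * w ∈ (StarAlgebra.adjoin ℂ G).topologicalClosure)
    (h2 : w * star w ∈ (StarAlgebra.adjoin ℂ G).topologicalClosure)
    (hG : ∀ g ∈ G, star w * g * w ∈ (StarAlgebra.adjoin ℂ G).topologicalClosure) :
    ∀ g ∈ (StarAlgebra.adjoin ℂ G).topologicalClosure,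
      star w * g * w ∈ (StarAlgebra.adjoin ℂ G).topologicalClosure := by
  set D := (StarAlgebra.adjoin ℂ G).topologicalClosure with hDdef
  have hDc : IsClosed (D : Set A) := StarSubalgebra.isClosed_topologicalClosure _
  have hle : StarAlgebra.adjoin ℂ G ≤ D := StarSubalgebra.le_topologicalClosure _
  intro g hg
  refine hDc.closure_subset (map_mem_closure (t := (D : Set A)) (f := fun g => star w * g * w)
    ((continuous_const_mul _).mul continuous_const) hg ?_)
  intro x hx
  change star w * x * w ∈ D
  induction hx using StarAlgebra.adjoin_induction with
  | mem x hx => exact hG x hx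
  | algebraMap c =>
    have : star w * (algebraMap ℂ A c) * w = c • (star w * w) := by
      simp [Algebra.algebraMap_eq_smul_one]
    rw [this]
    exact D.smul_mem h1 c
  | add x y _ _ hx hy => simpa [mul_add, add_mul] using add_mem hx hy
  | mul x y hx hy hx' hy' =>
    refine mem_of_forall_norm_sub_le hDc fun ε hε => ?_
    obtain ⟨e, heD, hes, hn⟩ := exists_mul_approx hDc h1
      (div_pos hε (by positivity : 0 < ‖x * y * w‖ + 1))
    refine ⟨e * (star w * x * w) * (star w * y * w), mul_mem (mul_mem heD hx') hy', ?_⟩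
    have e1 : star w * (x * y) * w - e * (star w * x * w) * (star w * y * w) =
        star (w - w * (star w * w) * e) * (x * y * w) := by
      have := hab _ (hle hx) _ h2
      simp only [star_sub, star_mul, star_star, hes]
      linear_combination (norm := noncomm_ring) - e * star w * this * y * w
    rw [e1]
    calc _ ≤ (ε / (‖x * y * w‖ + 1)) * ‖x * y * w‖ :=
          (norm_mul_le _ _).trans (by rw [norm_star]; gcongr)
      _ ≤ (ε / (‖x * y * w‖ + 1)) * (‖x * y * w‖ + 1) := by gcongr; linarith
      _ = ε := by field_simp
  | star x _ hx => simpa [mul_assoc] using star_mem hx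

end Generate

section Gelfand

lemma norm_le_of_forall_character_aux {P : Type*} [CommCStarAlgebra P] {y : P} {ε : ℝ} (hε : 0 ≤ ε)
    (h : ∀ σ : characterSpace ℂ P, ‖σ y‖ ≤ ε) : ‖y‖ ≤ ε := by
  rw [← (gelfandTransform_isometry P).norm_map_of_map_zero (map_zero _)]
  exact (ContinuousMap.norm_le _ hε).2 h

lemma exists_bump_aux {P : Type*} [CommCStarAlgebra P] {K : Set (characterSpace ℂ P)}
    (hK : IsClosed K) {σ : characterSpace ℂ P} (hσ : σ ∉ K) :
    ∃ d : P, σ d = 1 ∧ (∀ τ ∈ K, τ d = 0) ∧ ‖d‖ ≤ 1 := by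
  obtain ⟨f, hf0, hf1, hf⟩ := exists_continuous_zero_one_of_isClosed hK
    (isClosed_singleton (x := σ)) (Set.disjoint_singleton_right.2 hσ)
  obtain ⟨d, hd⟩ := (gelfandStarTransform P).surjective
    ⟨fun τ => (f τ : ℂ), Complex.continuous_ofReal.comp f.continuous⟩
  have hdτ : ∀ τ : characterSpace ℂ P, τ d = (f τ : ℂ) := fun τ => DFunLike.congr_fun hd τ
  refine ⟨d, ?_, fun τ hτ => ?_, norm_le_of_forall_character_aux zero_le_one fun τ => ?_⟩
  · rw [hdτ, hf1 rfl]; simp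
  · rw [hdτ, hf0 hτ]; simp
  · rw [hdτ, Complex.norm_real, Real.norm_eq_abs, abs_le]
    exact ⟨by linarith [(hf τ).1], (hf τ).2⟩

variable {D : StarSubalgebra ℂ A}

lemma norm_le_of_forall_character (hD : IsInclusion D) {y : D} {ε : ℝ} (hε : 0 ≤ ε)
    (h : ∀ σ : characterSpace ℂ D, ‖σ y‖ ≤ ε) : ‖y‖ ≤ ε := by
  let _ : CStarAlgebra A := {}
  have := hD.2
  let _ : CommCStarAlgebra D :=
    { (inferInstance : CStarAlgebra D) with
      mul_comm := fun x y => Subtype.ext (hD.1 x x.2 y y.2) }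
  exact norm_le_of_forall_character_aux hε h

/-- Characters vanishing on all of the spectrum detect zero. -/
lemma eq_zero_of_forall_character (hD : IsInclusion D) {y : D}
    (h : ∀ σ : characterSpace ℂ D, σ y = 0) : y = 0 := by
  have := norm_le_of_forall_character hD le_rfl (y := y) fun σ => by simp [h σ]
  simpa using this

lemma eq_of_forall_character (hD : IsInclusion D) {x y : D}
    (h : ∀ σ : characterSpace ℂ D, σ x = σ y) : x = y :=
  sub_eq_zero.1 (eq_zero_of_forall_character hD fun σ => by simp [h σ])

lemma exists_bump (hD : IsInclusion D) {K : Set (characterSpace ℂ D)}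
    (hK : IsClosed K) {σ : characterSpace ℂ D} (hσ : σ ∉ K) :
    ∃ d : D, σ d = 1 ∧ (∀ τ ∈ K, τ d = 0) ∧ ‖d‖ ≤ 1 := by
  let _ : CStarAlgebra A := {}
  have := hD.2
  let _ : CommCStarAlgebra D :=
    { (inferInstance : CStarAlgebra D) with
      mul_comm := fun x y => Subtype.ext (hD.1 x x.2 y y.2) }
  exact exists_bump_aux hK hσ

lemma continuous_character_apply (d : D) : Continuous fun σ : characterSpace ℂ D => σ d :=
  (WeakDual.eval_continuous d).comp continuous_subtype_val

/-- Restriction of characters along a `*`-homomorphism of inclusions. -/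
noncomputable def charRestrict {D₁ : StarSubalgebra ℂ B} (α : A →⋆ₐ[ℂ] B)
    (h : ∀ d ∈ D, α d ∈ D₁) (hD : IsInclusion D) : C(characterSpace ℂ D₁, characterSpace ℂ D) :=
  have : CompleteSpace D := hD.2.completeSpace_coe
  { toFun := fun σ => CharacterSpace.equivAlgHom.symm
      ((CharacterSpace.toAlgHom σ).comp
        (((α : A →ₐ[ℂ] B).comp D.toSubalgebra.val).codRestrict D₁.toSubalgebra
          fun d => h d d.2) : D →ₐ[ℂ] ℂ)
    continuous_toFun := by
      refine Continuous.subtype_mk (WeakDual.continuous_of_continuous_eval fun d => ?_) _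
      exact continuous_character_apply (⟨α d, h d d.2⟩ : D₁) }

lemma charRestrict_apply {D₁ : StarSubalgebra ℂ B} {α : A →⋆ₐ[ℂ] B}
    {h : ∀ d ∈ D, α d ∈ D₁} {hD : IsInclusion D} (σ : characterSpace ℂ D₁) (d : D) :
    charRestrict α h hD σ d = σ ⟨α d, h d d.2⟩ := rfl

lemma charRestrict_surjective {D₁ : StarSubalgebra ℂ B} {α : A →⋆ₐ[ℂ] B}
    (hα : Function.Injective α) {h : ∀ d ∈ D, α d ∈ D₁} {hD : IsInclusion D}
    (hD₁ : IsInclusion D₁) : Function.Surjective (charRestrict α h hD) := by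
  intro σ
  by_contra hσ
  have : CompleteSpace D₁ := hD₁.2.completeSpace_coe
  obtain ⟨d, hd1, hd0, -⟩ := exists_bump hD
    (isCompact_range (charRestrict α h hD).continuous).isClosed (σ := σ)
    (fun ⟨τ, hτ⟩ => hσ ⟨τ, hτ⟩)
  have h1 : (⟨α d, h d d.2⟩ : D₁) = 0 := eq_zero_of_forall_character hD₁ fun τ => by
    rw [← charRestrict_apply (hD := hD)]
    exact hd0 _ ⟨τ, rfl⟩
  have h2 : d = 0 := by
    have := congrArg Subtype.val h1
    exact Subtype.ext (hα (by simpa using this))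
  simp [h2] at hd1

end Gelfand

section Essential

variable {D : StarSubalgebra ℂ A} {D₁ : StarSubalgebra ℂ B} {α : A →⋆ₐ[ℂ] B}

lemma EssentialExtIn.eq_zero_of_mem (hess : EssentialExtIn D D₁ α) {J : Set D₁} (hJ : IsClosed J)
    (h0 : 0 ∈ J) (hadd : ∀ {x y}, x ∈ J → y ∈ J → x + y ∈ J) (hneg : ∀ {x}, x ∈ J → -x ∈ J)
    (hl : ∀ {x y}, y ∈ J → x * y ∈ J) (hr : ∀ {x y}, x ∈ J → x * y ∈ J)
    (h : ∀ y ∈ J, ∀ d ∈ D, α d = y → y = 0) : ∀ y ∈ J, y = 0 := by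
  have hcoe : ((TwoSidedIdeal.mk' J h0 hadd hneg hl hr : TwoSidedIdeal D₁) : Set D₁) = J := by
    ext y; simp
  have hbot := hess (TwoSidedIdeal.mk' J h0 hadd hneg hl hr) (by rwa [hcoe]) (by
    rw [hcoe]
    ext y
    constructor
    · rintro ⟨hy, d, hd, hdy⟩
      exact h y hy d hd hdy
    · rintro rfl
      exact ⟨h0, 0, D.zero_mem, by simp⟩)
  intro y hy
  have : y ∈ (TwoSidedIdeal.mk' J h0 hadd hneg hl hr : TwoSidedIdeal D₁) := by
    rw [← SetLike.mem_coe, hcoe]; exact hy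
  rw [hbot] at this
  simpa using this

lemma EssentialExtIn.eq_zero_of_annihilates (hess : EssentialExtIn D D₁ α) (hab : IsAbelian D₁)
    {f g : B} (hf : f ∈ D₁) (hg : g ∈ D₁) (hfg : f * g = 0)
    (h : ∀ d ∈ D, α d * f = 0 → α d * g = 0) : g = 0 := by
  have key := hess.eq_zero_of_mem (J := {y | ∀ z : D₁, (z : B) * g = 0 → (y : B) * z = 0}) ?_ ?_ ?_
    ?_ ?_ ?_ ?_ ⟨g, hg⟩ ?_
  · simpa using congrArg Subtype.val key
  · simp only [Set.ofPred_forall]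
    refine isClosed_iInter fun z => isClosed_iInter fun _ => ?_
    exact isClosed_eq (by fun_prop) continuous_const
  · intro z _; simp
  · intro x y hx hy z hz
    simp [add_mul, hx z hz, hy z hz]
  · intro x hx z hz
    simp [hx z hz]
  · intro x y hy z hz
    simp [mul_assoc, hy z hz]
  · intro x y hx z hz
    have := hab _ y.2 _ z.2
    simp only [MulMemClass.coe_mul]
    rw [mul_assoc, this, ← mul_assoc, hx z hz, zero_mul]
  · intro y hy d hd hdy
    have h1 : (y : B) * f = 0 := hy ⟨f, hf⟩ hfg
    have h2 : (y : B) * g = 0 := by rw [← hdy]; exact h d hd (by rw [hdy, h1])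
    have h3 : star (y : B) * g = 0 := by
      rw [← CStarRing.star_mul_self_eq_zero_iff]
      have e1 := hab _ y.2 _ (star_mem y.2)
      simp only [star_mul, star_star]
      linear_combination (norm := noncomm_ring) star g * e1 * g + star g * star (y : B) * h2
    have h4 := hy (star y) h3
    exact Subtype.ext (CStarRing.mul_star_self_eq_zero_iff _ |>.1 h4)
  · intro z hz
    rw [← hz]; exact hab _ hg _ z.2

lemma EssentialExtIn.conj_mul_eq_zero (hess : EssentialExtIn D D₁ α) (hab : IsAbelian D₁)
    {w : B} (hw : w ∈ normSet D₁) (hc : ∀ d ∈ D, w * α d = α d * w)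
    {p q : B} (hp : p ∈ D₁) (hq : q ∈ D₁) (hpq : p * q = 0) :
    (w * p * star w) * q * (w * star w) = 0 := by
  have hu := hw.1 q hq
  have hv := hw.2 p hp
  have ht := normSet.mul_star_self_mem hw
  have e : w * (p * (star w * q * w)) * star w = (w * p * star w) * q * (w * star w) := by
    simp only [mul_assoc]
  rw [← e]
  refine hess.eq_zero_of_annihilates hab (f := p * (star w * q * w)) (mul_mem hp hu)
    (hw.2 _ (mul_mem hp hu)) ?_ fun d hd h => ?_
  · rw [e]
    have c1 := hab _ (mul_mem hu hv) _ hq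
    linear_combination (norm := noncomm_ring) p * c1 * w * star w +
      hpq * (star w * q * w) * (w * p * star w) * (w * star w)
  · have := hc d hd
    linear_combination (norm := noncomm_ring) - this * p * (star w * q * w) * star w +
      w * h * star w

lemma EssentialExtIn.conj_eq (hess : EssentialExtIn D D₁ α) (hD₁ : IsInclusion D₁)
    {w : B} (hw : w ∈ normSet D₁) (hc : ∀ d ∈ D, w * α d = α d * w)
    {a : B} (ha : a ∈ D₁) : w * a * star w = a * (w * star w) := by
  have hab := hD₁.1
  have : CompleteSpace D₁ := hD₁.2.completeSpace_coe
  have ht := normSet.mul_star_self_mem hw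
  have ht' := normSet.star_mul_self_mem hw
  let θ : D₁ →ₗ[ℂ] D₁ :=
    { toFun := fun a => ⟨w * a * star w, hw.2 a a.2⟩
      map_add' := fun x y => Subtype.ext (by simp [mul_add, add_mul])
      map_smul' := fun c x => Subtype.ext (by simp) }
  let t : D₁ := ⟨w * star w, ht⟩
  have hθ1 : θ 1 = t := Subtype.ext (by simp [θ, t])
  have hθ : ∀ x y : D₁, θ x * θ y = θ (x * y) * t := fun x y => Subtype.ext (by
    have := hab _ ht' _ y.2
    simp only [θ, t, LinearMap.coe_mk, AddHom.coe_mk, MulMemClass.coe_mul]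
    linear_combination (norm := noncomm_ring) w * x * this * star w)
  suffices h : θ ⟨a, ha⟩ = ⟨a, ha⟩ * t by simpa [θ, t] using congrArg Subtype.val h
  refine eq_of_forall_character hD₁ fun σ => ?_
  rw [map_mul]
  by_cases hσ : σ t = 0
  · have := congrArg σ (hθ ⟨a, ha⟩ ⟨a, ha⟩)
    simp only [map_mul, hσ, mul_zero, mul_self_eq_zero] at this
    rw [this, hσ, mul_zero]
  let τ : characterSpace ℂ D₁ := CharacterSpace.equivAlgHom.symm
    (AlgHom.ofLinearMap ((σ t)⁻¹ • ((CharacterSpace.toAlgHom σ).toLinearMap ∘ₗ θ))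
      (by simp [hθ1, hσ])
      (fun x y => by
        have := congrArg σ (hθ x y)
        simp only [map_mul] at this
        simp only [LinearMap.smul_apply, LinearMap.comp_apply, AlgHom.toLinearMap_apply,
          CharacterSpace.toAlgHom_apply, smul_eq_mul]
        field_simp
        exact (mul_comm _ _).trans this.symm))
  have hτ : ∀ x, τ x = (σ t)⁻¹ * σ (θ x) := fun x => rfl
  suffices h : τ = σ by
    have := hτ ⟨a, ha⟩
    rw [h] at this
    rw [this]; field_simp
  by_contra hne
  obtain ⟨U, V, hU, hV, hτU, hσV, hUV⟩ := t2_separation hne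
  obtain ⟨p, hp1, hp0, -⟩ := exists_bump hD₁ hU.isClosed_compl (σ := τ) (by simpa)
  obtain ⟨q, hq1, hq0, -⟩ := exists_bump hD₁ hV.isClosed_compl (σ := σ) (by simpa)
  have hpq : p * q = 0 := eq_zero_of_forall_character hD₁ fun ρ => by
    rw [map_mul]
    by_cases hρ : ρ ∈ U
    · rw [hq0 ρ (Set.disjoint_left.1 hUV hρ), mul_zero]
    · rw [hp0 ρ hρ, zero_mul]
  have h0 : θ p * q * t = 0 := Subtype.ext
    (hess.conj_mul_eq_zero hab hw hc p.2 q.2 (congrArg Subtype.val hpq))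
  have h1 := congrArg σ h0
  rw [hτ] at hp1
  simp only [map_mul, hq1, mul_one, map_zero, mul_eq_zero, hσ, or_false] at h1
  simp [h1] at hp1

lemma EssentialExtIn.map_mem_of_commute (hess : EssentialExtIn D D₁ α) (hD₁ : IsInclusion D₁)
    (hm : IsMasa D₁) (hα : IsRegularHom D D₁ α) {x : A} (hx : x ∈ normSet D)
    (hc : ∀ d ∈ D, x * d = d * x) : α x ∈ D₁ := by
  set w := α x with hw
  have hwn : w ∈ normSet D₁ := hα.2 x hx
  have key : ∀ a ∈ D₁, star w * a * w = a * (star w * w) := fun a ha => by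
    have := hess.conj_eq hD₁ (normSet.star_mem hwn) (fun d hd => ?_) ha
    · simpa using this
    · rw [hw, ← StarHomClass.map_star, ← map_mul, ← map_mul]
      have := congrArg star (hc (star d) (star_mem hd))
      simp only [star_mul, star_star] at this
      rw [this]
  refine hm.2 w fun a ha => sub_eq_zero.1 ?_
  rw [← CStarRing.star_mul_self_eq_zero_iff]
  have h1 := key a ha
  have h2 := key _ (star_mem ha)
  have h3 := key _ (mul_mem (star_mem ha) ha)
  have h4 := hm.1 _ ha _ (normSet.star_mul_self_mem hwn)
  simp only [star_sub, star_mul]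
  linear_combination (norm := noncomm_ring) h3 - star a * h1 - h2 * a

end Essential

section Quotient

lemma image_eq_topologicalClosure_adjoin {P Q : Type*}
    [NormedRing P] [StarRing P] [CStarRing P] [CompleteSpace P] [NormedAlgebra ℂ P] [StarModule ℂ P]
    [NormedRing Q] [StarRing Q] [CStarRing Q] [CompleteSpace Q] [NormedAlgebra ℂ Q] [StarModule ℂ Q]
    {S : StarSubalgebra ℂ P} (hS : IsClosed (S : Set P)) (f : P →⋆ₐ[ℂ] Q) {G : Set Q}
    (hG : ∀ g ∈ G, ∃ s ∈ S, f s = g)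
    (hle : ∀ s ∈ S, f s ∈ (StarAlgebra.adjoin ℂ G).topologicalClosure) :
    f '' S = ((StarAlgebra.adjoin ℂ G).topologicalClosure : Set Q) := by
  refine Set.Subset.antisymm (Set.image_subset_iff.2 hle) ?_
  have hcl := isClosed_image_starSubalgebra hS f
  have h1 : StarAlgebra.adjoin ℂ G ≤ S.map f := StarAlgebra.adjoin_le fun g hg => hG g hg
  rw [← StarSubalgebra.coe_map] at hcl ⊢
  exact StarSubalgebra.topologicalClosure_minimal h1 hcl

/-- The data of a conditional expectation on the image of a regular inclusion extends to the
`C*`-algebra generated by the image and the range of the expectation. -/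
lemma exists_starSubalgebra_condExp {P : Type*} [NormedRing P] [StarRing P] [CStarRing P]
    [CompleteSpace P] [NormedAlgebra ℂ P] [StarModule ℂ P] {D : StarSubalgebra ℂ A}
    (hreg : IsRegularIncl D) {F : P →ₗ[ℂ] P} (hF : Continuous F) {β : A →⋆ₐ[ℂ] P}
    {D' : StarSubalgebra ℂ P}
    (hD' : (StarAlgebra.adjoin ℂ (F '' Set.range β)).topologicalClosure = D')
    (hab : IsAbelian D') (hright : ∀ d ∈ D', ∀ x, F (x * d) = F x * d)
    (hid : ∀ d ∈ D, F (β d) = β d)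
    (hconj : ∀ v ∈ normSet D, ∀ x, F (star (β v) * x * β v) = star (β v) * F x * β v) :
    ∃ T : StarSubalgebra ℂ P, IsClosed (T : Set P) ∧ (∀ x, β x ∈ T) ∧ D' ≤ T ∧
      ∀ t ∈ T, F t ∈ D' := by
  let _ : CStarAlgebra P := {}
  let _ : CStarAlgebra A := {}
  have hβ : Continuous β := AddMonoidHomClass.continuous_of_bound β 1 fun x => by
    simpa using NonUnitalStarAlgHom.norm_apply_le β x
  have hDc : IsClosed (D' : Set P) := hD' ▸ StarSubalgebra.isClosed_topologicalClosure _
  have hFm : ∀ x, F (β x) ∈ D' := fun x => hD' ▸ StarSubalgebra.le_topologicalClosure _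
    (StarAlgebra.subset_adjoin ℂ _ ⟨β x, ⟨x, rfl⟩, rfl⟩)
  have hβm : ∀ d ∈ D, β d ∈ D' := fun d hd => hid d hd ▸ hFm d
  have hss : ∀ v ∈ normSet D, star (β v) * β v ∈ D' := fun v hv => by
    rw [← StarHomClass.map_star, ← map_mul]
    exact hβm _ (normSet.star_mul_self_mem hv)
  have hstar : ∀ v ∈ normSet D, β (star v) = star (β v) := fun v _ => StarHomClass.map_star β v
  have hcm : ∀ v ∈ normSet D, ∀ d ∈ D', star (β v) * d * β v ∈ D' := by
    intro v hv d hd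
    subst hD'
    refine conj_mem_topologicalClosure_adjoin hab (hss v hv) ?_ ?_ d hd
    · simpa [hstar v hv] using hss _ (normSet.star_mem hv)
    · rintro _ ⟨_, ⟨x, rfl⟩, rfl⟩
      rw [← hconj v hv, ← hstar v hv, ← map_mul, ← map_mul]
      exact hFm _
  have hN : β '' normSet D ⊆ normSet D' := by
    rintro _ ⟨v, hv, rfl⟩
    refine ⟨hcm v hv, fun d hd => ?_⟩
    simpa [hstar v hv] using hcm _ (normSet.star_mem hv) d hd
  obtain ⟨T, hT⟩ := exists_starSubalgebra_eq_closure_span hDc hab hN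
    ⟨1, mem_normSet_of_mem D.one_mem, map_one β⟩
    (by rintro _ ⟨v, hv, rfl⟩; exact ⟨star v, normSet.star_mem hv, hstar v hv⟩)
    (by rintro _ ⟨v, hv, rfl⟩ _ ⟨w, hw, rfl⟩; exact ⟨v * w, normSet.mul_mem hv hw, map_mul β v w⟩)
  have hTc : IsClosed (T : Set P) := hT ▸ isClosed_closure
  have hgen : ∀ v ∈ normSet D, ∀ d ∈ D', β v * d ∈ T := fun v hv d hd => by
    rw [← SetLike.mem_coe, hT]
    exact subset_closure (Submodule.subset_span ⟨β v, ⟨v, hv, rfl⟩, d, hd, rfl⟩)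
  refine ⟨T, hTc, fun x => ?_, fun d hd => ?_, fun t ht => ?_⟩
  · have hx : x ∈ closure (Submodule.span ℂ (normSet D) : Set A) := hreg.2 ▸ Set.mem_univ x
    refine hTc.closure_subset (map_mem_closure hβ hx fun y hy => ?_)
    rw [SetLike.mem_coe] at hy ⊢
    induction hy using Submodule.span_induction with
    | mem y hy => simpa using hgen y hy 1 D'.one_mem
    | zero => simp
    | add y z _ _ h1 h2 => simpa using add_mem h1 h2
    | smul c y _ h1 => simpa using T.smul_mem h1 c
  · simpa using hgen 1 (mem_normSet_of_mem D.one_mem) d hd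
  · rw [← SetLike.mem_coe, hT] at ht
    refine hDc.closure_subset (map_mem_closure hF ht fun y hy => ?_)
    rw [SetLike.mem_coe] at hy ⊢
    induction hy using Submodule.span_induction with
    | mem y hy =>
      obtain ⟨_, ⟨v, hv, rfl⟩, d, hd, rfl⟩ := hy
      rw [hright d hd]
      exact mul_mem (hFm v) hd
    | zero => simp
    | add y z _ _ h1 h2 => simpa using add_mem h1 h2
    | smul c y _ h1 => simpa using D'.smul_mem h1 c

variable {B' : Type*} [NormedRing B'] [StarRing B'] [CStarRing B'] [CompleteSpace B']
  [NormedAlgebra ℂ B'] [StarModule ℂ B'] [PartialOrder B'] [StarOrderedRing B']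

/-- If every character of `D₀` matches a character of `D₁` on the common algebra, then
the package `(B', D₀, α₀)` is a quotient of the package `(B, D₁, α)`. -/
lemma exists_quotientMap {D : StarSubalgebra ℂ A} (hreg : IsRegularIncl D)
    {D₁ : StarSubalgebra ℂ B} {α : A →⋆ₐ[ℂ] B} {E₁ : B →ₗ[ℂ] B} (h₁ : IsPackage D D₁ α E₁)
    (hm₁ : IsMasa D₁) {D₀ : StarSubalgebra ℂ B'} {α₀ : A →⋆ₐ[ℂ] B'} {E₀ : B' →ₗ[ℂ] B'}
    (h₀ : IsPackage D D₀ α₀ E₀) (hm₀ : IsMasa D₀) (hE₁ : IsCondExp D₁ E₁) (hE₀ : IsCondExp D₀ E₀)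
    (hmatch : ∀ σ₀ : characterSpace ℂ D₀, ∃ σ₁ : characterSpace ℂ D₁, ∀ x : A,
      charExt hE₁ σ₁ (α x) = charExt hE₀ σ₀ (α₀ x)) :
    ∃ q : B →⋆ₐ[ℂ] B', Function.Surjective q ∧ (∀ x, q (α x) = α₀ x) ∧
      q '' (D₁ : Set B) = D₀ := by
  obtain ⟨hr₁, -, hα₁, -, -, hg₁, hd₁⟩ := h₁
  obtain ⟨hr₀, -, hα₀, -, hf₀, hg₀, hd₀⟩ := h₀
  let β : A →⋆ₐ[ℂ] B × B' := α.prod α₀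
  let F : B × B' →ₗ[ℂ] B × B' := E₁.prodMap E₀
  have hF : Continuous F := hE₁.continuous.prodMap hE₀.continuous
  have hFa : ∀ y, F y = (E₁ y.1, E₀ y.2) := fun _ => rfl
  have hβa : ∀ x, β x = (α x, α₀ x) := fun _ => rfl
  obtain ⟨D', hD'⟩ : ∃ D', (StarAlgebra.adjoin ℂ (F '' Set.range β)).topologicalClosure = D' :=
    ⟨_, rfl⟩
  have hDc : IsClosed (D' : Set (B × B')) := hD' ▸ StarSubalgebra.isClosed_topologicalClosure _
  have hFm : ∀ x, F (β x) ∈ D' := fun x => hD' ▸ StarSubalgebra.le_topologicalClosure _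
    (StarAlgebra.subset_adjoin ℂ _ ⟨β x, ⟨x, rfl⟩, rfl⟩)
  have hcomp : ∀ g ∈ D', g.1 ∈ D₁ ∧ g.2 ∈ D₀ := by
    have : D' ≤ D₁.comap (StarAlgHom.fst ℂ B B') ⊓ D₀.comap (StarAlgHom.snd ℂ B B') := by
      rw [← hD']
      refine StarSubalgebra.topologicalClosure_minimal (StarAlgebra.adjoin_le ?_) ?_
      · rintro _ ⟨_, ⟨x, rfl⟩, rfl⟩
        exact ⟨hE₁.mem _, hE₀.mem _⟩
      · exact (hr₁.1.2.preimage continuous_fst).inter (hr₀.1.2.preimage continuous_snd)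
    exact fun g hg => this hg
  have hab : IsAbelian D' := fun x hx y hy => Prod.ext
    (hm₁.1 _ (hcomp x hx).1 _ (hcomp y hy).1) (hm₀.1 _ (hcomp x hx).2 _ (hcomp y hy).2)
  obtain ⟨T, hTc, hβT, hDT, hFT⟩ := exists_starSubalgebra_condExp hreg hF hD' hab
    (fun d hd x => Prod.ext (hE₁.right (hcomp d hd).1 _) (hE₀.right (hcomp d hd).2 _))
    (fun d hd => Prod.ext (hE₁.idOn _ (hα₁.1 d hd)) (hE₀.idOn _ (hα₀.1 d hd)))
    (fun v hv x => Prod.ext (hE₁.map_conj hr₁ hm₁ (hα₁.2 v hv) _)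
      (hE₀.map_conj hr₀ hm₀ (hα₀.2 v hv) _))
  have hchar : ∀ g ∈ D', g.1 = 0 → g.2 = 0 := by
    intro g hg hg1
    have : (⟨g.2, (hcomp g hg).2⟩ : D₀) = 0 := eq_zero_of_forall_character hr₀.1 fun σ₀ => by
      obtain ⟨σ₁, hσ⟩ := hmatch σ₀
      have key : ∀ g ∈ D', charExt hE₁ σ₁ g.1 = charExt hE₀ σ₀ g.2 := by
        intro g hg
        rw [← hD', ← SetLike.mem_coe, StarSubalgebra.topologicalClosure_coe] at hg
        refine closure_minimal (s := (StarAlgebra.adjoin ℂ (F '' Set.range β) : Set (B × B')))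
          (t := {g | charExt hE₁ σ₁ g.1 = charExt hE₀ σ₀ g.2}) ?_
          (isClosed_eq (by fun_prop) (by fun_prop)) hg
        intro y hy
        have hle : StarAlgebra.adjoin ℂ (F '' Set.range β) ≤ D' :=
          hD' ▸ StarSubalgebra.le_topologicalClosure _
        change charExt hE₁ σ₁ y.1 = charExt hE₀ σ₀ y.2
        induction hy using StarAlgebra.adjoin_induction with
        | mem y hy =>
          obtain ⟨_, ⟨x, rfl⟩, rfl⟩ := hy
          simp only [hFa, hβa, charExt_map, hσ]
        | algebraMap c =>
          simp [Algebra.algebraMap_eq_smul_one, charExt_one]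
        | add x y _ _ hx hy => simp [hx, hy]
        | mul x y hx hy hx' hy' =>
          simp only [Prod.fst_mul, Prod.snd_mul]
          rw [charExt_left (hcomp x (hle hx)).1, charExt_left (hcomp x (hle hx)).2, hx', hy']
        | star x _ hx =>
          simp only [Prod.fst_star, Prod.snd_star]
          rw [charExt_star hr₁.1.2, charExt_star hr₀.1.2, hx]
      have := key g hg
      rw [hg1, map_zero] at this
      rw [← charExt_coe (hE := hE₀)]
      exact this.symm
    exact congrArg Subtype.val this
  let f : T →⋆ₐ[ℂ] B := (StarAlgHom.fst ℂ B B').comp T.subtype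
  have hfa : ∀ t, f t = (t : B × B').1 := fun _ => rfl
  have hinj : Function.Injective f := by
    rw [injective_iff_map_eq_zero]
    rintro ⟨⟨b, b'⟩, ht⟩ (rfl : b = 0)
    have h1 : F (star (0, b') * (0, b')) ∈ D' := hFT _ (mul_mem (star_mem ht) ht)
    have h2 := hchar _ h1 (by simp [hFa])
    have h3 : b' = 0 := hf₀ b' (by simpa [hFa] using h2)
    exact Subtype.ext (by simp [h3])
  have hfst : StarAlgHom.fst ℂ B B' '' T = Set.univ := by
    rw [image_eq_topologicalClosure_adjoin hTc (G := Set.range α ∪ E₁ '' Set.range α), hg₁]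
    · rfl
    · rintro _ (⟨x, rfl⟩ | ⟨_, ⟨x, rfl⟩, rfl⟩)
      · exact ⟨β x, hβT x, rfl⟩
      · exact ⟨F (β x), hDT (hFm x), rfl⟩
    · intro s _; rw [hg₁]; trivial
  have hsnd : StarAlgHom.snd ℂ B B' '' T = Set.univ := by
    rw [image_eq_topologicalClosure_adjoin hTc (G := Set.range α₀ ∪ E₀ '' Set.range α₀), hg₀]
    · rfl
    · rintro _ (⟨x, rfl⟩ | ⟨_, ⟨x, rfl⟩, rfl⟩)
      · exact ⟨β x, hβT x, rfl⟩
      · exact ⟨F (β x), hDT (hFm x), rfl⟩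
    · intro s _; rw [hg₀]; trivial
  have hfstD : StarAlgHom.fst ℂ B B' '' D' = D₁ := by
    rw [image_eq_topologicalClosure_adjoin hDc (G := E₁ '' Set.range α), hd₁]
    · rintro _ ⟨_, ⟨x, rfl⟩, rfl⟩
      exact ⟨F (β x), hFm x, rfl⟩
    · intro s hs; rw [hd₁]; exact (hcomp s hs).1
  have hsndD : StarAlgHom.snd ℂ B B' '' D' = D₀ := by
    rw [image_eq_topologicalClosure_adjoin hDc (G := E₀ '' Set.range α₀), hd₀]
    · rintro _ ⟨_, ⟨x, rfl⟩, rfl⟩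
      exact ⟨F (β x), hFm x, rfl⟩
    · intro s hs; rw [hd₀]; exact (hcomp s hs).2
  have hsurj : Function.Surjective f := fun b => by
    obtain ⟨t, ht, rfl⟩ : b ∈ StarAlgHom.fst ℂ B B' '' T := hfst ▸ Set.mem_univ b
    exact ⟨⟨t, ht⟩, rfl⟩
  let e : T ≃⋆ₐ[ℂ] B := StarAlgEquiv.ofBijective f ⟨hinj, hsurj⟩
  let q : B →⋆ₐ[ℂ] B' := ((StarAlgHom.snd ℂ B B').comp T.subtype).comp (e.symm : B →⋆ₐ[ℂ] T)
  have hq : ∀ t ∈ T, q t.1 = t.2 := fun t ht => by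
    have : e.symm t.1 = ⟨t, ht⟩ := by
      rw [← e.symm_apply_apply ⟨t, ht⟩]; rfl
    change ((e.symm t.1 : T) : B × B').2 = t.2
    rw [this]
  refine ⟨q, fun b' => ?_, fun x => hq _ (hβT x), ?_⟩
  · obtain ⟨t, ht, rfl⟩ : b' ∈ StarAlgHom.snd ℂ B B' '' T := hsnd ▸ Set.mem_univ b'
    exact ⟨t.1, hq t ht⟩
  · rw [← hfstD, ← hsndD, Set.image_image]
    exact Set.image_congr fun t ht => hq t (hDT ht)

end Quotient

section Matching

lemma EssentialExtIn.charRestrict_irreducible {D : StarSubalgebra ℂ A} {D₁ : StarSubalgebra ℂ B}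
    {α : A →⋆ₐ[ℂ] B} (hess : EssentialExtIn D D₁ α) (h : ∀ d ∈ D, α d ∈ D₁) (hD : IsInclusion D)
    (hD₁ : IsInclusion D₁) {K : Set (characterSpace ℂ D₁)} (hK : IsClosed K)
    (hKs : charRestrict α h hD '' K = Set.univ) : K = Set.univ := by
  by_contra hne
  obtain ⟨σ, hσ⟩ := (Set.ne_univ_iff_exists_notMem K).1 hne
  obtain ⟨y, hy1, hy0, -⟩ := exists_bump hD₁ hK hσ
  have key := hess.eq_zero_of_mem (J := {y | ∀ τ ∈ K, τ y = 0}) ?_ ?_ ?_ ?_ ?_ ?_ ?_ y hy0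
  · simp [key] at hy1
  · simp only [Set.ofPred_forall]
    exact isClosed_iInter fun τ => isClosed_iInter fun _ =>
      isClosed_eq (map_continuous τ) continuous_const
  · intro τ _; simp
  · intro x y hx hy τ hτ; simp [hx τ hτ, hy τ hτ]
  · intro x hx τ hτ; simp [hx τ hτ]
  · intro x y hy τ hτ; simp [hy τ hτ]
  · intro x y hx τ hτ; simp [hx τ hτ]
  · intro y hy d hd hdy
    have : (⟨d, hd⟩ : D) = 0 := eq_zero_of_forall_character hD fun ρ => by
      obtain ⟨τ, hτ, rfl⟩ : ρ ∈ charRestrict α h hD '' K := hKs ▸ Set.mem_univ ρ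
      rw [charRestrict_apply]
      convert hy τ hτ
    have hd0 : d = 0 := congrArg Subtype.val this
    exact Subtype.ext (by rw [← hdy, hd0]; simp)

/-- The fibre product of a surjection with an irreducible surjection contains a compact subset
which maps irreducibly to the base. -/
lemma exists_irreducible_fibreProduct.{u, v} {X₁ : Type u} {X₀ : Type v} {X : Type*} [TopologicalSpace X₁] [TopologicalSpace X₀]
    [TopologicalSpace X] [CompactSpace X₁] [T2Space X₁] [CompactSpace X₀] [T2Space X₀]
    [T2Space X] {p₁ : X₁ → X} {p₀ : X₀ → X} (h₁ : Continuous p₁) (h₀ : Continuous p₀)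
    (hs₁ : p₁.Surjective)
    (hirr : ∀ K : Set X₀, IsClosed K → p₀ '' K = Set.univ → K = Set.univ) :
    ∃ Z : Set (X₁ × X₀), (∀ z ∈ Z, p₁ z.1 = p₀ z.2) ∧ (∀ b, ∃ z ∈ Z, z.2 = b) ∧
      ∀ W : Set (X₁ × X₀), IsOpen W → (W ∩ Z).Nonempty →
        ∃ U : Set X, IsOpen U ∧ U.Nonempty ∧ ∀ z ∈ Z, p₀ z.2 ∈ U → z ∈ W := by
  let R : Set (X₁ × X₀) := {z | p₁ z.1 = p₀ z.2}
  have hR : IsClosed R := isClosed_eq (h₁.comp continuous_fst) (h₀.comp continuous_snd)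
  have : CompactSpace R := isCompact_iff_compactSpace.1 hR.isCompact
  have hg : Continuous (fun z : R => (z : X₁ × X₀).2) := continuous_snd.comp continuous_subtype_val
  have hgs : (fun z : R => ULift.up.{u} (z : X₁ × X₀).2).Surjective := fun b => by
    obtain ⟨a, ha⟩ := hs₁ (p₀ b.down)
    exact ⟨⟨(a, b.down), ha⟩, rfl⟩
  obtain ⟨Z, hZc, hZs, hZm⟩ := exists_compact_surjective_zorn_subset (continuous_uliftUp.comp hg) hgs
  refine ⟨Subtype.val '' Z, ?_, fun b => ?_, fun W hW hne => ?_⟩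
  · rintro _ ⟨z, -, rfl⟩; exact z.2
  · obtain ⟨z, hz, hzb⟩ := hZs.ge (Set.mem_univ (ULift.up b))
    exact ⟨z, ⟨z, hz, rfl⟩, congrArg ULift.down hzb⟩
  · let C : Set Z := {z | ((z : R) : X₁ × X₀) ∉ W}
    have hC : IsClosed C := hW.isClosed_compl.preimage
      (continuous_subtype_val.comp continuous_subtype_val)
    obtain ⟨_, hzW, z, hz, rfl⟩ := hne
    have hC' : C ≠ Set.univ := fun h => (h ▸ Set.mem_univ (⟨z, hz⟩ : Z) : (⟨z, hz⟩ : Z) ∈ C) hzW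
    have hK := hZm C hC' hC
    set K := Z.domRestrict (fun z : R => (z : X₁ × X₀).2) '' C with hKdef
    have hKc : IsCompact K := hC.isCompact.image (hg.comp continuous_subtype_val)
    refine ⟨(p₀ '' K)ᶜ, (hKc.image h₀).isClosed.isOpen_compl, ?_, ?_⟩
    · rw [Set.nonempty_compl]
      refine fun h => hK (Set.eq_univ_of_forall fun b => ?_)
      obtain ⟨z, hz, hzb⟩ := (hirr K hKc.isClosed h).ge (Set.mem_univ b.down)
      exact ⟨z, hz, congrArg ULift.up hzb⟩
    · rintro _ ⟨z', hz', rfl⟩ hzU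
      by_contra hW'
      have hzK : (z' : X₁ × X₀).2 ∈ K := ⟨⟨z', hz'⟩, hW', rfl⟩
      exact hzU (Set.mem_image_of_mem p₀ hzK)

section Single

variable {D : StarSubalgebra ℂ A} {D₁ : StarSubalgebra ℂ B} {α : A →⋆ₐ[ℂ] B} {E : B →ₗ[ℂ] B}
  {hE : IsCondExp D₁ E} {σ : characterSpace ℂ D₁} {h : ∀ d ∈ D, α d ∈ D₁} {hD : IsInclusion D}

lemma continuous_charExt_apply (hE : IsCondExp D₁ E) (x : B) :
    Continuous fun σ : characterSpace ℂ D₁ => charExt hE σ x :=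
  continuous_character_apply (⟨E x, hE.mem x⟩ : D₁)

lemma charExt_map_coe (d : D) : charExt hE σ (α d) = charRestrict α h hD σ d :=
  charExt_coe (⟨α d, h d d.2⟩ : D₁)

lemma charExt_map_mul (x : A) (d : D) :
    charExt hE σ (α (x * d)) = charExt hE σ (α x) * charRestrict α h hD σ d := by
  rw [map_mul, charExt_right (h d d.2), charExt_map_coe]

lemma charExt_map_conj (hα : IsRegularHom D D₁ α) (hab : IsAbelian D₁) {v : A}
    (hv : v ∈ normSet D) (d : D) (h0 : charExt hE σ (α v) ≠ 0) :
    charRestrict α hα.1 hD σ ⟨star v * d * v, hv.1 d d.2⟩ = charRestrict α hα.1 hD σ d *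
      charRestrict α hα.1 hD σ ⟨star v * v, normSet.star_mul_self_mem hv⟩ := by
  have e := congrArg (charExt hE σ) (hE.mul_conj hab (hα.2 v hv) (hα.1 d d.2))
  rw [← StarHomClass.map_star, ← map_mul, ← map_mul, ← map_mul,
    charExt_right (hα.1 _ (hv.1 d d.2)), charExt_right (hα.1 _ (normSet.star_mul_self_mem hv)),
    charExt_left (hα.1 d d.2), charExt_map, charExt_map_coe (h := hα.1) (hD := hD) d,
    charExt_map_coe (h := hα.1) (hD := hD) ⟨star v * d * v, hv.1 d d.2⟩,
    charExt_map_coe (h := hα.1) (hD := hD) ⟨star v * v, normSet.star_mul_self_mem hv⟩] at e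
  refine mul_left_cancel₀ h0 ?_
  rw [e]; ring

end Single

/-- If `σ(v* d v) = σ(d) σ(v* v)` on the support of `h`, then `v h` commutes with `D`. -/
lemma commute_of_fixed {D : StarSubalgebra ℂ A} (hD : IsInclusion D) {v : A} (hv : v ∈ normSet D)
    {h : D} (hfix : ∀ σ : characterSpace ℂ D, σ h ≠ 0 → ∀ d : D,
      σ ⟨star v * d * v, hv.1 d d.2⟩ = σ d * σ ⟨star v * v, normSet.star_mul_self_mem hv⟩) :
    ∀ d ∈ D, (v * h) * d = d * (v * h) := by
  intro d hd
  rw [← sub_eq_zero, ← CStarRing.star_mul_self_eq_zero_iff]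
  let θ : D → D := fun a => ⟨star v * a * v, hv.1 a a.2⟩
  let t : D := ⟨star v * v, normSet.star_mul_self_mem hv⟩
  let δ : D := ⟨d, hd⟩
  have hz : star δ * star h * t * h * δ - star δ * star h * θ δ * h
      - star h * θ (star δ) * h * δ + star h * θ (star δ * δ) * h = 0 := by
    refine eq_zero_of_forall_character hD fun σ => ?_
    simp only [map_add, map_sub, map_mul]
    by_cases hσ : σ h = 0
    · simp [hσ]
    · have := hfix σ hσ
      change ∀ d : D, σ (θ d) = σ d * σ t at this
      simp only [this, map_mul]
      ring
  have hz' := congrArg Subtype.val hz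
  simp only [θ, t, δ, AddMemClass.coe_add, AddSubgroupClass.coe_sub, MulMemClass.coe_mul,
    ZeroMemClass.coe_zero, StarMemClass.coe_star] at hz'
  simp only [star_sub, star_mul]
  linear_combination (norm := noncomm_ring) hz'

variable {B' : Type*} [NormedRing B'] [StarRing B'] [CStarRing B'] [CompleteSpace B']
  [NormedAlgebra ℂ B'] [StarModule ℂ B'] [PartialOrder B'] [StarOrderedRing B']

variable {D : StarSubalgebra ℂ A} {D₁ : StarSubalgebra ℂ B} {D₀ : StarSubalgebra ℂ B'}
  {α : A →⋆ₐ[ℂ] B} {α₀ : A →⋆ₐ[ℂ] B'} {E₁ : B →ₗ[ℂ] B} {E₀ : B' →ₗ[ℂ] B'}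
  {Z : Set (characterSpace ℂ D₁ × characterSpace ℂ D₀)}

/-- Matching for elements of `A` sent by `α₀` into `D₀`. -/
lemma charExt_eq_of_map_mem (hD : IsInclusion D) (hD₁ : IsInclusion D₁) (hD₀ : IsInclusion D₀)
    (hE₁ : IsCondExp D₁ E₁) (hE₀ : IsCondExp D₀ E₀) (h₁ : ∀ d ∈ D, α d ∈ D₁)
    (h₀ : ∀ d ∈ D, α₀ d ∈ D₀) (hinj : Function.Injective α₀)
    (hZ : ∀ z ∈ Z, charRestrict α h₁ hD z.1 = charRestrict α₀ h₀ hD z.2)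
    (hZs : ∀ b, ∃ z ∈ Z, z.2 = b)
    (hsurj : Function.Surjective (charRestrict α₀ h₀ hD))
    (hirr : ∀ W : Set (characterSpace ℂ D₁ × characterSpace ℂ D₀), IsOpen W → (W ∩ Z).Nonempty →
        ∃ U : Set (characterSpace ℂ D), IsOpen U ∧ U.Nonempty ∧
          ∀ z ∈ Z, charRestrict α₀ h₀ hD z.2 ∈ U → z ∈ W)
    {x : A} (hx : α₀ x ∈ D₀) {z₀} (hz₀ : z₀ ∈ Z) :
    charExt hE₁ z₀.1 (α x) = charExt hE₀ z₀.2 (α₀ x) := by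
  by_contra hne
  obtain ⟨C, hC0, hC⟩ := hE₁.exists_bound
  set μ := charExt hE₀ z₀.2 (α₀ x) with hμ
  set ν := charExt hE₁ z₀.1 (α x) with hν
  have hδ : 0 < ‖ν - μ‖ := norm_pos_iff.2 (sub_ne_zero.2 hne)
  set ε := ‖ν - μ‖ / (2 * (C + 1)) with hε
  have hε0 : 0 < ε := by positivity
  obtain ⟨U, hU, ⟨σ, hσ⟩, hUW⟩ := hirr
    {z | ‖charExt hE₁ z.1 (α x) - ν‖ < ‖ν - μ‖ / 2 ∧ ‖charExt hE₀ z.2 (α₀ x) - μ‖ < ε}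
    ((isOpen_lt ((((continuous_charExt_apply hE₁ (α x)).comp continuous_fst).sub
      continuous_const).norm) continuous_const).inter
      (isOpen_lt ((((continuous_charExt_apply hE₀ (α₀ x)).comp continuous_snd).sub
      continuous_const).norm) continuous_const))
    ⟨z₀, ⟨by simpa [← hν] using hδ, by simpa [← hμ] using hε0⟩, hz₀⟩
  obtain ⟨k, hk1, hk0, hkn⟩ := exists_bump hD hU.isClosed_compl (σ := σ) (by simpa)
  obtain ⟨z, hz, hzσ⟩ : ∃ z ∈ Z, charRestrict α₀ h₀ hD z.2 = σ := by
    obtain ⟨τ, hτ⟩ := hsurj σ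
    obtain ⟨z, hz, rfl⟩ := hZs τ
    exact ⟨z, hz, hτ⟩
  have hzW := hUW z hz (hzσ ▸ hσ)
  set y := x - algebraMap ℂ A μ with hy
  have hyk : α₀ (y * k) ∈ D₀ := by
    rw [map_mul, hy, map_sub, AlgHomClass.commutes]
    exact mul_mem (sub_mem hx (algebraMap_mem D₀ μ)) (h₀ k k.2)
  have hα₀y : ∀ τ, charExt hE₀ τ (α₀ y) = charExt hE₀ τ (α₀ x) - μ := fun τ => by
    simp [hy, Algebra.algebraMap_eq_smul_one, charExt_one]
  have hαy : ∀ τ, charExt hE₁ τ (α y) = charExt hE₁ τ (α x) - μ := fun τ => by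
    simp [hy, Algebra.algebraMap_eq_smul_one, charExt_one]
  have hn0 : ‖(⟨α₀ (y * k), hyk⟩ : D₀)‖ ≤ ε := by
    refine norm_le_of_forall_character hD₀ hε0.le fun τ => ?_
    rw [← charExt_coe (hE := hE₀), charExt_map_mul (h := h₀) (hD := hD), hα₀y, norm_mul]
    by_cases hτ : charRestrict α₀ h₀ hD τ ∈ U
    · obtain ⟨z', hz', rfl⟩ := hZs τ
      have h2 := (hUW z' hz' hτ).2.le
      have h3 := (characterSpace_norm_le hD.2 (charRestrict α₀ h₀ hD z'.2) k).trans hkn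
      calc _ ≤ ε * 1 := mul_le_mul h2 h3 (norm_nonneg _) hε0.le
        _ = ε := mul_one ε
    · rw [hk0 _ hτ]; simpa using hε0.le
  have hn : ‖y * (k : A)‖ ≤ ε := by
    let _ : CStarAlgebra A := {}
    let _ : CStarAlgebra B' := {}
    rw [← NonUnitalStarAlgHom.norm_map α₀ hinj]
    exact hn0
  have h4 : ‖charExt hE₁ z.1 (α (y * k))‖ ≤ C * ε := by
    let _ : CStarAlgebra A := {}
    let _ : CStarAlgebra B := {}
    calc _ ≤ ‖E₁ (α (y * k))‖ := characterSpace_norm_le hD₁.2 z.1 _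
      _ ≤ C * ‖α (y * k)‖ := hC _
      _ ≤ C * ‖y * (k : A)‖ := by
        gcongr; exact NonUnitalStarAlgHom.norm_apply_le α _
      _ ≤ C * ε := by gcongr
  rw [charExt_map_mul (h := h₁) (hD := hD), hZ z hz, hzσ, hk1, mul_one, hαy] at h4
  have h5 : C * ε ≤ ‖ν - μ‖ / 2 := by
    rw [hε, mul_div_assoc', div_le_div_iff₀ (by positivity) two_pos]
    nlinarith
  have h6 := hzW.1
  have h7 : ‖ν - μ‖ ≤ ‖charExt hE₁ z.1 (α x) - ν‖ + ‖charExt hE₁ z.1 (α x) - μ‖ := by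
    rw [norm_sub_rev _ ν]
    exact norm_sub_le_norm_sub_add_norm_sub _ _ _
  linarith

/-- Every character of the expectation algebra of an envelope matches a character
of any Cartan package. -/
lemma exists_matching_character (hreg : IsRegularIncl D) (h₁ : IsPackage D D₁ α E₁)
    (h₀ : IsCartanEnvelope D D₀ α₀ E₀) (hE₁ : IsCondExp D₁ E₁) (hE₀ : IsCondExp D₀ E₀)
    (σ₀ : characterSpace ℂ D₀) : ∃ σ₁ : characterSpace ℂ D₁, ∀ x : A,
      charExt hE₁ σ₁ (α x) = charExt hE₀ σ₀ (α₀ x) := by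
  obtain ⟨⟨hr₀, hi₀, hα₀, -, -, -, -⟩, hm₀, hess⟩ := h₀
  obtain ⟨hr₁, hi₁, hα₁, -, -, -, -⟩ := h₁
  have hD := hreg.1
  have hD₁ := hr₁.1
  have hD₀ := hr₀.1
  have : CompleteSpace D := hD.2.completeSpace_coe
  have : CompleteSpace D₁ := hD₁.2.completeSpace_coe
  have : CompleteSpace D₀ := hD₀.2.completeSpace_coe
  have hs₀ : Function.Surjective (charRestrict α₀ hα₀.1 hD) := charRestrict_surjective hi₀ hD₀
  have hs₁ : Function.Surjective (charRestrict α hα₁.1 hD) := charRestrict_surjective hi₁ hD₁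
  obtain ⟨Z, hZ, hZs, hirr⟩ := exists_irreducible_fibreProduct
    (charRestrict α hα₁.1 hD).continuous (charRestrict α₀ hα₀.1 hD).continuous hs₁
    fun K => hess.charRestrict_irreducible hα₀.1 hD hD₀
  have hcomm : ∀ x ∈ normSet D, (∀ d ∈ D, x * d = d * x) → ∀ z ∈ Z,
      charExt hE₁ z.1 (α x) = charExt hE₀ z.2 (α₀ x) := fun x hx hc z hz =>
    charExt_eq_of_map_mem hD hD₁ hD₀ hE₁ hE₀ hα₁.1 hα₀.1 hi₀ hZ hZs hs₀ hirr
      (hess.map_mem_of_commute hD₀ hm₀ hα₀ hx hc) hz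
  have hnorm : ∀ v ∈ normSet D, ∀ z ∈ Z,
      charExt hE₁ z.1 (α v) = charExt hE₀ z.2 (α₀ v) := by
    intro v hv z₀ hz₀
    by_contra hne
    obtain ⟨U, hU, ⟨σ, hσ⟩, hUW⟩ := hirr
      {z | charExt hE₁ z.1 (α v) ≠ charExt hE₀ z.2 (α₀ v)}
      (isOpen_ne_fun ((continuous_charExt_apply hE₁ (α v)).comp continuous_fst)
        ((continuous_charExt_apply hE₀ (α₀ v)).comp continuous_snd)) ⟨z₀, hne, hz₀⟩
    have hlift : ∀ σ, ∃ z ∈ Z, charRestrict α₀ hα₀.1 hD z.2 = σ := fun σ => by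
      obtain ⟨τ, hτ⟩ := hs₀ σ
      obtain ⟨z, hz, rfl⟩ := hZs τ
      exact ⟨z, hz, hτ⟩
    obtain ⟨k, hk1, hk0, -⟩ := exists_bump hD hU.isClosed_compl (σ := σ) (by simpa)
    have hc := commute_of_fixed hD hv (h := k) fun ρ hρ d => by
      have hρU : ρ ∈ U := by by_contra hn; exact hρ (hk0 ρ hn)
      obtain ⟨z, hz, rfl⟩ := hlift ρ
      have hzW : charExt hE₁ z.1 (α v) ≠ charExt hE₀ z.2 (α₀ v) := hUW z hz hρU
      by_cases h0 : charExt hE₀ z.2 (α₀ v) = 0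
      · rw [h0] at hzW
        rw [← hZ z hz]
        exact charExt_map_conj hα₁ hD₁.1 hv d hzW
      · exact charExt_map_conj hα₀ hD₀.1 hv d h0
    obtain ⟨z, hz, hzσ⟩ := hlift σ
    have e := hcomm _ (normSet.mul_mem hv (mem_normSet_of_mem k.2)) hc z hz
    rw [charExt_map_mul (h := hα₁.1) (hD := hD), charExt_map_mul (h := hα₀.1) (hD := hD),
      hZ z hz, hzσ, hk1, mul_one, mul_one] at e
    exact hUW z hz (hzσ ▸ hσ) e
  obtain ⟨z, hz, rfl⟩ := hZs σ₀
  refine ⟨z.1, fun x => ?_⟩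
  let _ : CStarAlgebra A := {}
  let _ : CStarAlgebra B := {}
  let _ : CStarAlgebra B' := {}
  have hc : Continuous α := AddMonoidHomClass.continuous_of_bound α 1 fun x => by
    simpa using NonUnitalStarAlgHom.norm_apply_le α x
  have hc₀ : Continuous α₀ := AddMonoidHomClass.continuous_of_bound α₀ 1 fun x => by
    simpa using NonUnitalStarAlgHom.norm_apply_le α₀ x
  exact eq_of_regular hreg (F := ℂ)
    (f := (charExt hE₁ z.1).toLinearMap ∘ₗ (α : A →ₐ[ℂ] B).toLinearMap)
    (g := (charExt hE₀ z.2).toLinearMap ∘ₗ (α₀ : A →ₐ[ℂ] B').toLinearMap)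
    ((charExt hE₁ z.1).continuous.comp hc) ((charExt hE₀ z.2).continuous.comp hc₀)
    (fun v hv => hnorm v hv z hz) x

end Matching

/-- Minimality: if a regular inclusion `(A,D)` has a Cartan envelope and
`(B, D₁, α)` is any Cartan package for `(A,D)`, then there is a Cartan envelope
`(B₂, D₂, γ)` of `(A,D)` and a surjective `*`-homomorphism `q : B → B₂` with `q ∘ α = γ`,
`q(D₁) = D₂`, and `ker q ∩ α(A) = (0)`. -/
theorem stmt12 (D : StarSubalgebra ℂ A) (hreg : IsRegularIncl D)
    (hasEnv : ∃ (B₀ : CSA) (D₀ : StarSubalgebra ℂ B₀.carrier) (α₀ : A →⋆ₐ[ℂ] B₀.carrier)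
        (E₀ : B₀.carrier →ₗ[ℂ] B₀.carrier), IsCartanEnvelope D D₀ α₀ E₀)
    (D₁ : StarSubalgebra ℂ B) (α : A →⋆ₐ[ℂ] B) (E₁ : B →ₗ[ℂ] B)
    (hpkg : IsPackage D D₁ α E₁) (hmasa : IsMasa D₁) :
    ∃ (B₂ : CSA) (D₂ : StarSubalgebra ℂ B₂.carrier) (γ : A →⋆ₐ[ℂ] B₂.carrier)
        (E₂ : B₂.carrier →ₗ[ℂ] B₂.carrier) (q : B →⋆ₐ[ℂ] B₂.carrier),
      IsCartanEnvelope D D₂ γ E₂ ∧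
      Function.Surjective q ∧
      (∀ x : A, q (α x) = γ x) ∧
      ⇑q '' (D₁ : Set B) = (D₂ : Set B₂.carrier) ∧
      (∀ y : B, (∃ x : A, α x = y) → q y = 0 → y = 0) := by
  obtain ⟨B₀, D₀, α₀, E₀, henv⟩ := hasEnv
  obtain ⟨-, -, -, hE₁, -⟩ := id hpkg
  obtain ⟨-, hinj, -, hE₀, -⟩ := id henv.1
  obtain ⟨q, hq, hqα, hqD⟩ := exists_quotientMap hreg hpkg hmasa henv.1 henv.2.1 hE₁ hE₀
    (exists_matching_character hreg hpkg henv hE₁ hE₀)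
  refine ⟨B₀, D₀, α₀, E₀, q, henv, hq, hqα, hqD, ?_⟩
  rintro _ ⟨x, rfl⟩ hx
  rw [hqα, map_eq_zero_iff α₀ hinj] at hx
  rw [hx, map_zero]

end RegularInclusion
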